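/- arXiv:math/0602378 — 2 statements merged into one kernel-verified Lean document; each statement's English description precedes it below -/
import Mathlib

section
/- Let n = 2d and let A, B ∈ Sym(2d,ℝ) be linearly independent and form a non-dissipative pair. Let C := 2(BJA − AJB) ∈ Sym(2d,ℝ), so that Q_C = {Q_A, Q_B} is the Poisson bracket of Q_A and Q_B, and assume A, B, C are linearly independent. Assume moreover that either (i) minrank{A,B} ≥ 3 and maxrank{A,B} ≥ 17, or (ii) minrank{A,B} = 2, maxrank{A,B} ≥ 9, and the joint radical ker A ∩ ker B is either {0} or a symplectic subspace of ℝ^{2d}. Then there exists a point x ∈ ℝ^{2d} such that Q_A(x) = 0, Q_B(x) = 0, and Q_C(x) ≠ 0. -/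
open Matrix

/-- The standard symplectic matrix `J = [[0, I_d], [−I_d, 0]]` on `ℝ^{2d} = ℝ^d × ℝ^d`. -/
noncomputable def symplJ (d : ℕ) : Matrix (Fin d ⊕ Fin d) (Fin d ⊕ Fin d) ℝ :=
  Matrix.fromBlocks 0 1 (-1) 0

section CommonZeros

open Filter Topology Module

section RealAnalysis

/-- A `C¹` perturbation `f (t, ·)` of an affine isomorphism of `ℝ²` keeps a zero, continuously in
the parameter `t`. -/
lemma exists_zero_curve_of_contDiff (f : ℝ × (ℝ × ℝ) → ℝ × ℝ) (hf : ContDiff ℝ 1 f)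
    (M : (ℝ × ℝ) →L[ℝ] (ℝ × ℝ)) (hM : Function.Injective M) (c : ℝ × ℝ)
    (h0 : ∀ z, f (0, z) = M z + c) :
    ∃ (z : ℝ → ℝ × ℝ) (z₀ : ℝ × ℝ), Tendsto z (𝓝 0) (𝓝 z₀) ∧ ∀ᶠ t in 𝓝 0, f (t, z t) = 0 := by
  let e : (ℝ × ℝ) ≃L[ℝ] (ℝ × ℝ) :=
    (LinearEquiv.ofInjectiveEndo (M : (ℝ × ℝ) →ₗ[ℝ] (ℝ × ℝ)) hM).toContinuousLinearEquiv
  have he : (e : (ℝ × ℝ) →L[ℝ] (ℝ × ℝ)) = M := by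
    ext <;> simp [e]
  obtain ⟨z₀, hz₀⟩ := e.surjective (-c)
  have hz₀' : M z₀ = -c := by rw [← he]; exact hz₀
  have hd : HasStrictFDerivAt f (fderiv ℝ f (0, z₀)) (0, z₀) :=
    hf.contDiffAt.hasStrictFDerivAt (by simp)
  have hinr : (fderiv ℝ f (0, z₀)) ∘L .inr ℝ ℝ (ℝ × ℝ) = M := by
    have h1 : HasFDerivAt (fun z : ℝ × ℝ => f (0, z))
        ((fderiv ℝ f (0, z₀)) ∘L .inr ℝ ℝ (ℝ × ℝ)) z₀ :=
      hd.hasFDerivAt.comp z₀ (hasFDerivAt_prodMk_right (0 : ℝ) z₀)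
    have h2 : HasFDerivAt (fun z : ℝ × ℝ => f (0, z)) M z₀ := by
      simp only [h0]
      exact M.hasFDerivAt.add_const c
    exact h1.unique h2
  have hinv : ((fderiv ℝ f (0, z₀)) ∘L .inr ℝ ℝ (ℝ × ℝ)).IsInvertible := by
    rw [hinr]; exact ⟨e, he⟩
  refine ⟨hd.implicitFunctionOfProdDomain hinv, z₀,
    hd.tendsto_implicitFunctionOfProdDomain hinv, ?_⟩
  filter_upwards [hd.eventually_apply_implicitFunctionOfProdDomain hinv] with t ht
  rw [ht, h0, hz₀', neg_add_cancel]

/-- A real polynomial of degree at most four which vanishes near `0` has zero coefficients. -/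
lemma coeff_eq_zero_of_eventually_quartic_eq_zero (a b c d e : ℝ)
    (h : ∀ᶠ s in 𝓝 (0 : ℝ), a + b * s + c * s ^ 2 + d * s ^ 3 + e * s ^ 4 = 0) :
    a = 0 ∧ b = 0 ∧ c = 0 ∧ d = 0 ∧ e = 0 := by
  let P : Polynomial ℝ := .C a + .C b * .X + .C c * .X ^ 2 + .C d * .X ^ 3 + .C e * .X ^ 4
  have hP : P = 0 := by
    apply Polynomial.eq_zero_of_infinite_isRoot
    apply infinite_of_mem_nhds (0 : ℝ)
    filter_upwards [h] with s hs
    simpa [P] using hs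
  have hc : ∀ n, P.coeff n = 0 := fun n => by rw [hP]; simp
  have h0 := hc 0
  have h1 := hc 1
  have h2 := hc 2
  have h3 := hc 3
  have h4 := hc 4
  simp [P, Polynomial.coeff_X, Polynomial.coeff_X_pow, Polynomial.coeff_C] at h0 h1 h2 h3 h4
  exact ⟨h0, h1, h2, h3, h4⟩

/-- A real quadratic with leading and constant coefficients of opposite signs has roots of opposite
signs. -/
lemma exists_roots_of_opposite_signs (a b c : ℝ) (ha : 0 < a) (hc : c < 0) :
    ∃ r s : ℝ, r < 0 ∧ 0 < s ∧ a * r ^ 2 + 2 * b * r + c = 0 ∧ a * s ^ 2 + 2 * b * s + c = 0 ∧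
      a * (r * s) = c := by
  have hD : 0 < b ^ 2 - a * c := by nlinarith [mul_pos ha (neg_pos.mpr hc), sq_nonneg b]
  set D := Real.sqrt (b ^ 2 - a * c) with hDdef
  have hsq : D ^ 2 = b ^ 2 - a * c := Real.sq_sqrt hD.le
  have hlt : |b| < D := by
    apply abs_lt_of_sq_lt_sq _ (Real.sqrt_nonneg _)
    rw [hsq]
    nlinarith [mul_pos ha (neg_pos.mpr hc)]
  obtain ⟨h1, h2⟩ := abs_lt.mp hlt
  refine ⟨(-b - D) / a, (-b + D) / a, div_neg_of_neg_of_pos (by linarith) ha,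
    div_pos (by linarith) ha, ?_, ?_, ?_⟩
  · field_simp; linear_combination hsq
  · field_simp; linear_combination hsq
  · field_simp; linear_combination -hsq

end RealAnalysis

section QuadraticForms

variable {V : Type*} [AddCommGroup V] [Module ℝ V]

lemma bilin_smul_add_smul (A : LinearMap.BilinForm ℝ V) (hA : ∀ x y, A x y = A y x) (a b : ℝ)
    (x y : V) : A (a • x + b • y) (a • x + b • y) =
      a ^ 2 * A x x + 2 * a * b * A x y + b ^ 2 * A y y := by
  simp only [map_add, map_smul, LinearMap.add_apply, LinearMap.smul_apply, smul_eq_mul]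
  linear_combination a * b * hA y x

lemma bilin_add_smul (A : LinearMap.BilinForm ℝ V) (hA : ∀ x y, A x y = A y x) (s : ℝ)
    (x y : V) : A (x + s • y) (x + s • y) = A x x + 2 * s * A x y + s ^ 2 * A y y := by
  simpa using bilin_smul_add_smul A hA 1 s x y

lemma bilin_polarization (A : LinearMap.BilinForm ℝ V) (hA : ∀ x y, A x y = A y x)
    (K : Submodule ℝ V) (h : ∀ x ∈ K, A x x = 0) : ∀ x ∈ K, ∀ y ∈ K, A x y = 0 := by
  intro x hx y hy
  have h1 := bilin_add_smul A hA 1 x y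
  rw [h _ (K.add_mem hx (K.smul_mem 1 hy)), h x hx, h y hy] at h1
  linarith

/-- The homogeneous S-lemma (Finsler): if `A` is indefinite and `B ≥ 0` on the cone `A = 0`, then
`B + tA` is positive semidefinite for some `t`. -/
lemma exists_add_smul_nonneg (A B : LinearMap.BilinForm ℝ V) (hA : ∀ x y, A x y = A y x)
    (hB : ∀ x y, B x y = B y x) {u v : V} (hu : 0 < A u u) (hv : A v v < 0)
    (h : ∀ x, A x x = 0 → 0 ≤ B x x) : ∃ t : ℝ, ∀ x, 0 ≤ B x x + t * A x x := by
  have key : ∀ x z, 0 < A x x → A z z < 0 → B z z / A z z ≤ B x x / A x x := by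
    intro x z hx hz
    obtain ⟨r, s, hr, hs, er, es, hrs⟩ :=
      exists_roots_of_opposite_signs (A x x) (A x z) (A z z) hx hz
    have h1 := h (r • x + (1 : ℝ) • z) (by
      rw [bilin_smul_add_smul A hA]; linear_combination er)
    have h2 := h (s • x + (1 : ℝ) • z) (by
      rw [bilin_smul_add_smul A hA]; linear_combination es)
    rw [bilin_smul_add_smul B hB] at h1 h2
    have h3 : 0 ≤ (s - r) * (-(r * s) * B x x + B z z) := by
      nlinarith [mul_nonneg hs.le h1, mul_nonneg (neg_nonneg.mpr hr.le) h2]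
    have h4 : 0 ≤ -(r * s) * B x x + B z z := nonneg_of_mul_nonneg_right h3 (by linarith)
    have h5 : 0 ≤ -(A z z) * B x x + A x x * B z z := by
      have := mul_nonneg hx.le h4
      rw [← hrs]; linarith
    rw [div_le_iff_of_neg hz, div_mul_eq_mul_div, div_le_iff₀ hx]
    linarith
  let S : Set ℝ := {r | ∃ x, 0 < A x x ∧ r = B x x / A x x}
  have hS : S.Nonempty := ⟨_, u, hu, rfl⟩
  have hbdd : BddBelow S := ⟨B v v / A v v, by rintro _ ⟨x, hx, rfl⟩; exact key x v hx hv⟩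
  refine ⟨-sInf S, fun x => ?_⟩
  rcases lt_trichotomy (A x x) 0 with hx | hx | hx
  · have h1 : B x x / A x x ≤ sInf S :=
      le_csInf hS (by rintro _ ⟨y, hy, rfl⟩; exact key y x hy hx)
    rw [div_le_iff_of_neg hx] at h1
    linarith
  · rw [hx]; linarith [h x hx]
  · have h1 : sInf S ≤ B x x / A x x := csInf_le hbdd ⟨x, hx, rfl⟩
    rw [le_div_iff₀ hx] at h1
    linarith

/-- A quadratic form vanishing on an indefinite quadric is a multiple of its equation. -/
lemma exists_eq_mul_of_zero_on_quadric (A D : LinearMap.BilinForm ℝ V)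
    (hA : ∀ x y, A x y = A y x) (hD : ∀ x y, D x y = D y x) {u v : V} (hu : 0 < A u u)
    (hv : A v v < 0) (h : ∀ x, A x x = 0 → D x x = 0) : ∃ c : ℝ, ∀ x, D x x = c * A x x := by
  obtain ⟨t, ht⟩ := exists_add_smul_nonneg A D hA hD hu hv fun x hx => (h x hx).ge
  obtain ⟨s, hs⟩ := exists_add_smul_nonneg A (-D) hA (fun x y => by simp [hD x y]) hu hv
    fun x hx => by simp [h x hx]
  simp only [LinearMap.neg_apply] at hs
  have hst : s = -t := by
    have h1 : 0 ≤ (s + t) * A u u := by linarith [ht u, hs u]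
    have h2 : 0 ≤ (s + t) * A v v := by linarith [ht v, hs v]
    have h3 := nonneg_of_mul_nonneg_left h1 hu
    have h4 := nonpos_of_mul_nonneg_left h2 hv
    linarith
  refine ⟨-t, fun x => ?_⟩
  have h1 := ht x
  have h2 := hs x
  rw [hst] at h2
  linarith

/-- An indefinite form has an isotropic vector outside its kernel on which a given nonzero linear
form does not vanish. -/
lemma exists_isotropic_apply_ne_zero (A : LinearMap.BilinForm ℝ V) (hA : ∀ x y, A x y = A y x)
    {u v : V} (hu : 0 < A u u) (hv : A v v < 0) (φ : V →ₗ[ℝ] ℝ) (hφ : φ ≠ 0) :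
    ∃ y, A y y = 0 ∧ (∃ f, A y f ≠ 0) ∧ φ y ≠ 0 := by
  obtain ⟨p, hp⟩ : ∃ p, φ p ≠ 0 := by
    by_contra! hcon
    exact hφ (LinearMap.ext hcon)
  obtain ⟨u', hu', hφu⟩ : ∃ u', 0 < A u' u' ∧ φ u' ≠ 0 := by
    by_cases h : φ u = 0
    · have hc : Continuous fun s : ℝ => A u u + 2 * s * A u p + s ^ 2 * A p p := by fun_prop
      have h1 : ∀ᶠ s : ℝ in 𝓝[≠] 0, 0 < A u u + 2 * s * A u p + s ^ 2 * A p p :=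
        (hc.continuousAt.eventually_const_lt (by simpa using hu)).filter_mono nhdsWithin_le_nhds
      obtain ⟨s, hs, hs0⟩ := (h1.and self_mem_nhdsWithin).exists
      refine ⟨u + s • p, by rw [bilin_add_smul A hA]; exact hs, ?_⟩
      simpa [h, hp] using hs0
    · exact ⟨u, hu, h⟩
  obtain ⟨r, s, hr, hs, er, es, -⟩ :=
    exists_roots_of_opposite_signs (A v v * -1) (A v u' * -1) (A u' u' * -1) (by linarith)
      (by linarith)
  have main : ∀ a : ℝ, A v v * -1 * a ^ 2 + 2 * (A v u' * -1) * a + A u' u' * -1 = 0 →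
      A (u' + a • v) (u' + a • v) = 0 ∧ ∃ f, A (u' + a • v) f ≠ 0 := by
    intro a ha
    have h0 : A (u' + a • v) (u' + a • v) = 0 := by
      rw [bilin_add_smul A hA, hA u' v]; linear_combination -ha
    refine ⟨h0, ?_⟩
    by_contra! hcon
    have h1 := hcon u'
    have h2 := hcon v
    simp only [map_add, map_smul, LinearMap.add_apply, LinearMap.smul_apply, smul_eq_mul]
      at h1 h2
    have h3 := hA u' v
    nlinarith [sq_nonneg a]
  by_cases hφr : φ (u' + r • v) = 0
  · refine ⟨u' + s • v, (main s es).1, (main s es).2, fun hφs => ?_⟩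
    simp only [map_add, map_smul, smul_eq_mul] at hφr hφs
    have h1 : (s - r) * φ v = 0 := by linear_combination hφs - hφr
    have h2 : φ v = 0 := (mul_eq_zero.mp h1).resolve_left (by linarith)
    rw [h2] at hφr
    exact hφu (by linarith)
  · exact ⟨u' + r • v, (main r er).1, (main r er).2, hφr⟩

end QuadraticForms

section Dimension

variable {V : Type*} [AddCommGroup V] [Module ℝ V] [FiniteDimensional ℝ V]

lemma finrank_le_finrank_ker_add_one (φ : V →ₗ[ℝ] ℝ) :
    finrank ℝ V ≤ finrank ℝ (LinearMap.ker φ) + 1 := by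
  have h1 := LinearMap.finrank_range_add_finrank_ker φ
  have h2 := Submodule.finrank_le (LinearMap.range φ)
  rw [finrank_self] at h2
  omega

lemma finrank_le_finrank_inf_add {K L : Submodule ℝ V} {k l : ℕ}
    (hK : finrank ℝ V ≤ finrank ℝ K + k) (hL : finrank ℝ V ≤ finrank ℝ L + l) :
    finrank ℝ V ≤ finrank ℝ (K ⊓ L : Submodule ℝ V) + (k + l) := by
  have h1 := Submodule.finrank_sup_add_finrank_inf_eq K L
  have h2 := Submodule.finrank_le (K ⊔ L)
  omega

lemma finrank_range_add_le_of_isotropic (A : LinearMap.BilinForm ℝ V) (K : Submodule ℝ V)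
    (h : ∀ x ∈ K, ∀ y ∈ K, A x y = 0) :
    finrank ℝ (LinearMap.range A) + 2 * finrank ℝ K ≤ 2 * finrank ℝ V := by
  have h1 := LinearMap.finrank_range_add_finrank_ker A
  have h2 := LinearMap.finrank_range_add_finrank_ker (A.domRestrict K)
  have h3 : finrank ℝ (LinearMap.range (A.domRestrict K)) ≤ finrank ℝ K.dualAnnihilator := by
    apply Submodule.finrank_mono
    rintro _ ⟨x, rfl⟩
    rw [Submodule.mem_dualAnnihilator]
    exact fun y hy => h x x.2 y hy
  have h4 := Subspace.finrank_add_finrank_dualAnnihilator_eq K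
  have h5 : finrank ℝ (LinearMap.ker (A.domRestrict K)) ≤ finrank ℝ (LinearMap.ker A) := by
    rw [← Submodule.finrank_map_subtype_eq K (LinearMap.ker (A.domRestrict K))]
    apply Submodule.finrank_mono
    rintro _ ⟨x, hx, rfl⟩
    exact hx
  omega

/-- The form `A` does not vanish on any subspace of codimension at most `k`. -/
def NonvanishingOnCodim (A : LinearMap.BilinForm ℝ V) (k : ℕ) : Prop :=
  ∀ K : Submodule ℝ V, finrank ℝ V ≤ finrank ℝ K + k → ∃ x ∈ K, A x x ≠ 0

lemma nonvanishingOnCodim_of_lt_finrank_range (A : LinearMap.BilinForm ℝ V)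
    (hA : ∀ x y, A x y = A y x) (k : ℕ) (h : 2 * k < finrank ℝ (LinearMap.range A)) :
    NonvanishingOnCodim A k := by
  intro K hK
  by_contra! hcon
  have := finrank_range_add_le_of_isotropic A K (bilin_polarization A hA K hcon)
  omega

lemma NonvanishingOnCodim.mono {A : LinearMap.BilinForm ℝ V} {k l : ℕ}
    (h : NonvanishingOnCodim A k) (hlk : l ≤ k) : NonvanishingOnCodim A l :=
  fun K hK => h K (by omega)

/-- A form vanishing on a subspace of codimension `k` has kernel of codimension at most `2k`. -/
lemma finrank_le_finrank_ker_add_of_zero_on (A : LinearMap.BilinForm ℝ V)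
    (hA : ∀ x y, A x y = A y x) (K : Submodule ℝ V) (k : ℕ)
    (hK : finrank ℝ V ≤ finrank ℝ K + k) (h : ∀ x ∈ K, A x x = 0) :
    finrank ℝ V ≤ finrank ℝ (LinearMap.ker A) + 2 * k := by
  have h1 := finrank_range_add_le_of_isotropic A K (bilin_polarization A hA K h)
  have h2 := LinearMap.finrank_range_add_finrank_ker A
  omega

end Dimension

section ZariskiDensity

variable {V : Type*} [AddCommGroup V] [Module ℝ V]

/-- Stereographic parametrization of the quadric `A = 0` from one of its points `w`. -/
lemma bilin_stereographic (A B : LinearMap.BilinForm ℝ V)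
    (hA : ∀ x y, A x y = A y x) (hB : ∀ x y, B x y = B y x) {w v y : V} (hwv : A w v = 0)
    (s : ℝ) :
    let z := A (v + s • y) (v + s • y) • w + (-2 * A w (v + s • y)) • (v + s • y)
    B z z = (A v v + 2 * s * A v y + s ^ 2 * A y y) ^ 2 * B w w
      - 4 * s * (A v v + 2 * s * A v y + s ^ 2 * A y y) * A w y * (B w v + s * B w y)
      + 4 * s ^ 2 * A w y ^ 2 * (B v v + 2 * s * B v y + s ^ 2 * B y y) := by
  intro z
  have h1 : A (v + s • y) (v + s • y) = A v v + 2 * s * A v y + s ^ 2 * A y y :=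
    bilin_add_smul A hA s v y
  have h2 : A w (v + s • y) = s * A w y := by simp [hwv]
  have h3 : B w (v + s • y) = B w v + s * B w y := by simp
  simp only [z]
  rw [bilin_smul_add_smul B hB, h1, h2, h3, bilin_add_smul B hB]
  ring

lemma eventually_stereographic_neg (A B : LinearMap.BilinForm ℝ V)
    (hA : ∀ x y, A x y = A y x) (hB : ∀ x y, B x y = B y x) {w v y : V} (hwv : A w v = 0)
    (hw : A w w = 0) (hv : A v v ≠ 0) (hBw : B w w < 0) :
    ∀ᶠ s : ℝ in 𝓝 0,
      let z := A (v + s • y) (v + s • y) • w + (-2 * A w (v + s • y)) • (v + s • y)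
      A z z = 0 ∧ B z z < 0 := by
  have hc : Continuous fun s : ℝ => (A v v + 2 * s * A v y + s ^ 2 * A y y) ^ 2 * B w w
      - 4 * s * (A v v + 2 * s * A v y + s ^ 2 * A y y) * A w y * (B w v + s * B w y)
      + 4 * s ^ 2 * A w y ^ 2 * (B v v + 2 * s * B v y + s ^ 2 * B y y) := by fun_prop
  have h0 : (A v v + 2 * 0 * A v y + 0 ^ 2 * A y y) ^ 2 * B w w
      - 4 * 0 * (A v v + 2 * 0 * A v y + 0 ^ 2 * A y y) * A w y * (B w v + 0 * B w y)
      + 4 * 0 ^ 2 * A w y ^ 2 * (B v v + 2 * 0 * B v y + 0 ^ 2 * B y y) < 0 := by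
    have : 0 < A v v ^ 2 := by positivity
    nlinarith
  filter_upwards [hc.continuousAt.eventually_lt_const h0] with s hs
  intro z
  constructor
  · have := bilin_stereographic A A hA hA hwv (y := y) s
    simp only [z]
    rw [this, hw, hwv]; ring
  · have := bilin_stereographic A B hA hB hwv (y := y) s
    simp only [z]
    rw [this]
    exact hs

lemma zero_of_zero_on_negative_part_of_apply_ne_zero (A B D : LinearMap.BilinForm ℝ V)
    (hA : ∀ x y, A x y = A y x) (hB : ∀ x y, B x y = B y x) (hD : ∀ x y, D x y = D y x)
    (h : ∀ y, A y y = 0 → B y y < 0 → D y y = 0) {w v y : V} (hwv : A w v = 0)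
    (hw : A w w = 0) (hv : A v v ≠ 0) (hBw : B w w < 0) (hy : A y y = 0) (hwy : A w y ≠ 0) :
    D y y = 0 := by
  have hDw := h w hw hBw
  have h1 : ∀ᶠ s : ℝ in 𝓝 0, 0 + (- 4 * A v v * A w y * D w v) * s
      + (-8 * A v y * A w y * D w v - 4 * A v v * A w y * D w y + 4 * A w y ^ 2 * D v v) * s ^ 2
      + (-8 * A v y * A w y * D w y + 8 * A w y ^ 2 * D v y) * s ^ 3
      + (4 * A w y ^ 2 * D y y) * s ^ 4 = 0 := by
    filter_upwards [eventually_stereographic_neg A B hA hB hwv hw hv hBw (y := y)] with s hs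
    have h2 := h _ hs.1 hs.2
    rw [bilin_stereographic A D hA hD hwv s, hDw, hy] at h2
    linear_combination h2
  have h3 := (coeff_eq_zero_of_eventually_quartic_eq_zero _ _ _ _ _ h1).2.2.2.2
  have : 4 * A w y ^ 2 ≠ 0 := by positivity
  exact (mul_eq_zero.mp h3).resolve_left this

variable [FiniteDimensional ℝ V]

/-- On an indefinite quadric `A = 0` of rank at least three, a quadratic form vanishing on the
(nonempty) part where `B < 0` vanishes identically. -/
lemma zero_on_quadric_of_zero_on_negative_part (A B D : LinearMap.BilinForm ℝ V)
    (hA : ∀ x y, A x y = A y x) (hB : ∀ x y, B x y = B y x) (hD : ∀ x y, D x y = D y x)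
    {u v : V} (hu : 0 < A u u) (hv : A v v < 0) (hA1 : NonvanishingOnCodim A 1)
    {w : V} (hw : A w w = 0) (hBw : B w w < 0)
    (h : ∀ y, A y y = 0 → B y y < 0 → D y y = 0) : ∀ y, A y y = 0 → D y y = 0 := by
  obtain ⟨w, hw, hBw, p, hp⟩ : ∃ w, A w w = 0 ∧ B w w < 0 ∧ ∃ p, A w p ≠ 0 := by
    by_cases hAw : ∃ p, A w p ≠ 0
    · exact ⟨w, hw, hBw, hAw⟩
    push Not at hAw
    have hAu : A u ≠ 0 := fun h0 => by rw [h0] at hu; simp at hu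
    obtain ⟨y, hy, ⟨f, hf⟩, -⟩ := exists_isotropic_apply_ne_zero A hA hu hv (A u) hAu
    have hc : Continuous fun s : ℝ => B w w + 2 * s * B w y + s ^ 2 * B y y := by fun_prop
    have h1 : ∀ᶠ s : ℝ in 𝓝[≠] 0, B w w + 2 * s * B w y + s ^ 2 * B y y < 0 :=
      (hc.continuousAt.eventually_lt_const (by simpa using hBw)).filter_mono nhdsWithin_le_nhds
    obtain ⟨s, hs, hs0⟩ := (h1.and self_mem_nhdsWithin).exists
    refine ⟨w + s • y, ?_, ?_, f, ?_⟩
    · rw [bilin_add_smul A hA, hw, hy, hAw]; ring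
    · rw [bilin_add_smul B hB]; exact hs
    · simpa [hAw, hf] using hs0
  obtain ⟨v₀, hwv, hv₀⟩ := hA1 (LinearMap.ker (A w)) (finrank_le_finrank_ker_add_one _)
  rw [LinearMap.mem_ker] at hwv
  intro y hy
  by_cases hwy : A w y = 0
  swap
  · exact zero_of_zero_on_negative_part_of_apply_ne_zero A B D hA hB hD h hwv hw hv₀ hBw hy hwy
  by_cases hAy : ∃ q, A y q ≠ 0
  · obtain ⟨q, hq⟩ := hAy
    obtain ⟨p, hp, hyp⟩ : ∃ p, A w p ≠ 0 ∧ A y p ≠ 0 := by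
      by_cases h1 : A y p = 0
      · by_cases h2 : A w q = 0
        · exact ⟨p + q, by simpa [h2] using hp, by simpa [h1] using hq⟩
        · exact ⟨q, h2, hq⟩
      · exact ⟨p, hp, h1⟩
    have h1 : ∀ᶠ s : ℝ in 𝓝[≠] 0, A v₀ y + s * A p y ≠ 0 := by
      by_cases h2 : A v₀ y = 0
      · filter_upwards [self_mem_nhdsWithin] with s hs
        rw [h2, zero_add, hA p y]
        exact mul_ne_zero hs hyp
      · have hc : Continuous fun s : ℝ => A v₀ y + s * A p y := by fun_prop
        exact (hc.continuousAt.eventually_ne (by simpa using h2)).filter_mono nhdsWithin_le_nhds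
    have h2 := (eventually_stereographic_neg A B hA hB hwv hw hv₀ hBw (y := p)).filter_mono
      (nhdsWithin_le_nhds (s := {0}ᶜ))
    obtain ⟨s, ⟨hs1, hs2, hs3⟩, hs0⟩ := ((h1.and h2).and self_mem_nhdsWithin).exists
    set z := A (v₀ + s • p) (v₀ + s • p) • w + (-2 * A w (v₀ + s • p)) • (v₀ + s • p) with hz
    have hzy : A z y ≠ 0 := by
      have : A z y = -2 * s * A w p * (A v₀ y + s * A p y) := by
        have h3 : A w (v₀ + s • p) = s * A w p := by simp [hwv]
        rw [hz, h3]
        simp only [map_add, map_smul, LinearMap.add_apply, LinearMap.smul_apply, smul_eq_mul, hwy]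
        ring
      rw [this]
      exact mul_ne_zero (mul_ne_zero (mul_ne_zero (by norm_num) hs0) hp) hs1
    obtain ⟨v₁, hzv, hv₁⟩ := hA1 (LinearMap.ker (A z)) (finrank_le_finrank_ker_add_one _)
    rw [LinearMap.mem_ker] at hzv
    exact zero_of_zero_on_negative_part_of_apply_ne_zero A B D hA hB hD h hzv hs2 hv₁ hs3 hy hzy
  · push Not at hAy
    have hc : Continuous fun s : ℝ => B w w + 2 * s * B w y + s ^ 2 * B y y := by fun_prop
    have h1 : ∀ᶠ s : ℝ in 𝓝 0, B w w + 2 * s * B w y + s ^ 2 * B y y < 0 :=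
      hc.continuousAt.eventually_lt_const (by simpa using hBw)
    have h2 : ∀ᶠ s : ℝ in 𝓝 0, D w w + (2 * D w y) * s + D y y * s ^ 2 + 0 * s ^ 3
        + 0 * s ^ 4 = 0 := by
      filter_upwards [h1] with s hs
      have h3 := h (w + s • y) (by rw [bilin_add_smul A hA, hw, hy, hwy]; ring)
        (by rw [bilin_add_smul B hB]; exact hs)
      rw [bilin_add_smul D hD] at h3
      linear_combination h3
    exact (coeff_eq_zero_of_eventually_quartic_eq_zero _ _ _ _ _ h2).2.2.1

end ZariskiDensity

section Pencil

variable {V : Type*} [AddCommGroup V] [Module ℝ V]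

/-- No nonzero combination `aA + bB` (with respect to the coefficients) is positive semidefinite. -/
def IsNondissipative (A B : LinearMap.BilinForm ℝ V) : Prop :=
  ∀ a b : ℝ, (∀ x, 0 ≤ a * A x x + b * B x x) → a = 0 ∧ b = 0

lemma IsNondissipative.smul_add_smul {A B : LinearMap.BilinForm ℝ V} (h : IsNondissipative A B)
    (a b c d : ℝ) (hdet : a * d - b * c ≠ 0) :
    IsNondissipative (a • A + b • B) (c • A + d • B) := by
  intro r s hrs
  have h1 := h (r * a + s * c) (r * b + s * d) fun x => by
    have := hrs x
    simp only [LinearMap.add_apply, LinearMap.smul_apply, smul_eq_mul] at this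
    linarith
  constructor
  · exact (mul_eq_zero.mp (show r * (a * d - b * c) = 0 by
      linear_combination d * h1.1 - c * h1.2)).resolve_right hdet
  · exact (mul_eq_zero.mp (show s * (a * d - b * c) = 0 by
      linear_combination a * h1.2 - b * h1.1)).resolve_right hdet

lemma IsNondissipative.neg_right {A B : LinearMap.BilinForm ℝ V} (h : IsNondissipative A B) :
    IsNondissipative A (-B) := by
  intro a b hab
  have h1 := h a (-b) fun x => by
    have := hab x
    simp only [LinearMap.neg_apply] at this
    linarith
  exact ⟨h1.1, neg_eq_zero.mp h1.2⟩

lemma IsNondissipative.exists_pos {A B : LinearMap.BilinForm ℝ V} (h : IsNondissipative A B) :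
    ∃ u, 0 < A u u := by
  by_contra! hcon
  have := (h (-1) 0 fun x => by linarith [hcon x]).1
  norm_num at this

lemma IsNondissipative.exists_neg {A B : LinearMap.BilinForm ℝ V} (h : IsNondissipative A B) :
    ∃ u, A u u < 0 := by
  by_contra! hcon
  have := (h 1 0 fun x => by linarith [hcon x]).1
  norm_num at this

lemma IsNondissipative.exists_isotropic_neg {A B : LinearMap.BilinForm ℝ V}
    (h : IsNondissipative A B) (hA : ∀ x y, A x y = A y x) (hB : ∀ x y, B x y = B y x) :
    ∃ w, A w w = 0 ∧ B w w < 0 := by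
  by_contra! hcon
  obtain ⟨u, hu⟩ := h.exists_pos
  obtain ⟨v, hv⟩ := h.exists_neg
  obtain ⟨t, ht⟩ := exists_add_smul_nonneg A B hA hB hu hv hcon
  have := (h t 1 fun x => by linarith [ht x]).2
  norm_num at this

lemma IsNondissipative.exists_isotropic_pos {A B : LinearMap.BilinForm ℝ V}
    (h : IsNondissipative A B) (hA : ∀ x y, A x y = A y x) (hB : ∀ x y, B x y = B y x) :
    ∃ w, A w w = 0 ∧ 0 < B w w := by
  obtain ⟨w, hw, hBw⟩ := h.neg_right.exists_isotropic_neg hA (fun x y => by simp [hB x y])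
  exact ⟨w, hw, by simpa using hBw⟩

/-- If `F` is indefinite and a common zero of `F` and `G` lies in the kernel of `F` but not of `G`,
then `F` and `G` have a common zero at which their differentials are independent. -/
lemma exists_regular_zero_of_mem_ker (F G : LinearMap.BilinForm ℝ V)
    (hF : ∀ x y, F x y = F y x) (hG : ∀ x y, G x y = G y x) {u v x : V} (hu : 0 < F u u)
    (hv : F v v < 0) (hFx : F x = 0) (hGx : G x x = 0) (hGx' : G x ≠ 0) :
    ∃ z e f, F z z = 0 ∧ G z z = 0 ∧ F z e * G z f - F z f * G z e ≠ 0 := by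
  obtain ⟨y, hy, ⟨f, hf⟩, hxy⟩ := exists_isotropic_apply_ne_zero F hF hu hv (G x) hGx'
  have h1 : ∀ p, F x p = 0 := fun p => by rw [hFx]; rfl
  refine ⟨G y y • x + (-2 * G x y) • y, x, f, ?_, ?_, ?_⟩
  · rw [bilin_smul_add_smul F hF, h1, h1, hy]; ring
  · rw [bilin_smul_add_smul G hG, hGx]; ring
  · simp only [map_add, map_smul, LinearMap.add_apply, LinearMap.smul_apply, smul_eq_mul, h1,
      hF y x, hG y x, hGx]
    have : 0 + -2 * G x y * F y f ≠ 0 := by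
      rw [zero_add]; exact mul_ne_zero (mul_ne_zero (by norm_num) hxy) hf
    intro h2
    have h3 : F y f * (G x y) ^ 3 = 0 := by linear_combination -h2 / 4
    exact (mul_ne_zero hf (pow_ne_zero 3 hxy)) h3

lemma exists_zero_not_mem_ker (A B : LinearMap.BilinForm ℝ V) [FiniteDimensional ℝ V]
    (hA : ∀ x y, A x y = A y x) (hB : ∀ x y, B x y = B y x) (hA2 : NonvanishingOnCodim A 2)
    {w w' : V} (hw : A w w = 0) (hBw : B w w < 0) (hw' : A w' w' = 0) (hBw' : 0 < B w' w') :
    ∃ x f, A x x = 0 ∧ B x x = 0 ∧ (A x f ≠ 0 ∨ B x f ≠ 0) := by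
  by_cases hc : A w w' = 0
  · obtain ⟨r, s, -, -, er, -⟩ :=
      exists_roots_of_opposite_signs (B w' w') (B w w') (B w w) hBw' hBw
    have h1 : B (w + r • w') (w + r • w') = 0 := by
      rw [bilin_add_smul B hB]; linear_combination er
    refine ⟨w + r • w', w', ?_, h1, Or.inr fun h2 => ?_⟩
    · rw [bilin_add_smul A hA, hw, hw', hc]; ring
    · simp only [map_add, map_smul, LinearMap.add_apply, LinearMap.smul_apply, smul_eq_mul] at h2
      have h3 : B w w = r ^ 2 * B w' w' := by linear_combination er - 2 * r * h2
      linarith [mul_nonneg (sq_nonneg r) hBw'.le]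
  · obtain ⟨y, hy, hyy⟩ := hA2 (LinearMap.ker (A w) ⊓ LinearMap.ker (A w'))
      (finrank_le_finrank_inf_add (finrank_le_finrank_ker_add_one _)
        (finrank_le_finrank_ker_add_one _))
    rw [Submodule.mem_inf, LinearMap.mem_ker, LinearMap.mem_ker] at hy
    obtain ⟨hwy, hwy'⟩ := hy
    set k := A y y / (2 * A w w') with hk
    have hkc : 2 * A w w' * k = A y y := by rw [hk]; field_simp
    have hk0 : k ≠ 0 := by
      intro h0; rw [h0, mul_zero] at hkc; exact hyy hkc.symm
    let z : ℝ → V := fun s => s ^ 2 • w + (s * (1 - s)) • y + (-(1 - s) ^ 2 * k) • w'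
    have hz : ∀ (C : LinearMap.BilinForm ℝ V), (∀ x y, C x y = C y x) → ∀ s, C (z s) (z s) =
        s ^ 4 * C w w + s ^ 2 * (1 - s) ^ 2 * C y y + (1 - s) ^ 4 * k ^ 2 * C w' w'
        + 2 * s ^ 3 * (1 - s) * C w y - 2 * s ^ 2 * (1 - s) ^ 2 * k * C w w'
        - 2 * s * (1 - s) ^ 3 * k * C w' y := by
      intro C hC s
      simp only [z, map_add, map_smul, LinearMap.add_apply, LinearMap.smul_apply, smul_eq_mul]
      rw [hC y w, hC y w', hC w' w]
      ring
    have hcont : Continuous fun s => B (z s) (z s) := by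
      simp only [hz B hB]; fun_prop
    have h0 : 0 ≤ B (z 0) (z 0) := by
      rw [hz B hB]
      have := mul_pos (pow_pos (abs_pos.mpr hk0) 2) hBw'
      rw [sq_abs] at this
      linarith
    have h1 : B (z 1) (z 1) < 0 := by rw [hz B hB]; linarith
    obtain ⟨s, -, hs⟩ := intermediate_value_Icc' (zero_le_one' ℝ) hcont.continuousOn ⟨h1.le, h0⟩
    have hs' : B (z s) (z s) = 0 := hs
    refine ⟨z s, w, ?_, hs', Or.inl ?_⟩
    · rw [hz A hA, hw, hw', hwy, hwy', ← hkc]; ring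
    · have hs1 : 1 - s ≠ 0 := by
        intro h2
        have : s = 1 := by linarith
        rw [this] at hs'
        exact h1.ne hs'
      have : A (z s) w = -((1 - s) ^ 2 * k * A w w') := by
        simp only [z, map_add, map_smul, LinearMap.add_apply, LinearMap.smul_apply, smul_eq_mul]
        rw [hA y w, hA w' w, hw, hwy]; ring
      rw [this]
      exact neg_ne_zero.mpr (mul_ne_zero (mul_ne_zero (pow_ne_zero 2 hs1) hk0) hc)

/-- A nondissipative pair containing a form of large rank has a common zero at which the
differentials are independent. -/
lemma exists_regular_zero (A B : LinearMap.BilinForm ℝ V) [FiniteDimensional ℝ V]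
    (hA : ∀ x y, A x y = A y x) (hB : ∀ x y, B x y = B y x) (hA2 : NonvanishingOnCodim A 2)
    (hnd : IsNondissipative A B) :
    ∃ z e f, A z z = 0 ∧ B z z = 0 ∧ A z e * B z f - A z f * B z e ≠ 0 := by
  obtain ⟨w, hw, hBw⟩ := hnd.exists_isotropic_neg hA hB
  obtain ⟨w', hw', hBw'⟩ := hnd.exists_isotropic_pos hA hB
  obtain ⟨x, g, hAx, hBx, hg⟩ := exists_zero_not_mem_ker A B hA hB hA2 hw hBw hw' hBw'
  by_cases hreg : ∃ f, A x g * B x f - A x f * B x g ≠ 0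
  · obtain ⟨f, hf⟩ := hreg
    exact ⟨x, g, f, hAx, hBx, hf⟩
  push Not at hreg
  set b := A x g
  set a := B x g
  have hdet : a * a - (-b) * b ≠ 0 := by
    rcases hg with hg | hg
    · have : 0 < b ^ 2 := by positivity
      nlinarith [sq_nonneg a]
    · have : 0 < a ^ 2 := by positivity
      nlinarith [sq_nonneg b]
  have hnd' := hnd.smul_add_smul a (-b) b a hdet
  obtain ⟨u, hu⟩ := hnd'.exists_pos
  obtain ⟨v, hv⟩ := hnd'.exists_neg
  obtain ⟨z, e, f, hFz, hGz, hef⟩ := exists_regular_zero_of_mem_ker (a • A + (-b) • B)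
    (b • A + a • B) (fun x y => by simp [hA x y, hB x y]) (fun x y => by simp [hA x y, hB x y])
    hu hv (x := x) (by
      ext f
      simp only [LinearMap.add_apply, LinearMap.smul_apply, smul_eq_mul, LinearMap.zero_apply]
      linear_combination -hreg f)
    (by simp [hAx, hBx]) (by
      intro h0
      have h1 := LinearMap.congr_fun h0 g
      simp only [LinearMap.add_apply, LinearMap.smul_apply, smul_eq_mul, LinearMap.zero_apply]
        at h1
      apply hdet
      linear_combination h1)
  simp only [LinearMap.add_apply, LinearMap.smul_apply, smul_eq_mul] at hFz hGz hef
  refine ⟨z, e, f, ?_, ?_, ?_⟩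
  · exact (mul_eq_zero.mp (show (a * a - (-b) * b) * A z z = 0 by
      linear_combination a * hFz + b * hGz)).resolve_left hdet
  · exact (mul_eq_zero.mp (show (a * a - (-b) * b) * B z z = 0 by
      linear_combination a * hGz - b * hFz)).resolve_left hdet
  · intro h0
    apply hef
    linear_combination (a * a + b * b) * h0

end Pencil

section RegularZeros

variable {V : Type*} [AddCommGroup V] [Module ℝ V]

lemma bilin_add_smul_add_smul (C : LinearMap.BilinForm ℝ V) (hC : ∀ x y, C x y = C y x)
    (x y w : V) (t : ℝ) : C (x + t • y + t ^ 2 • w) (x + t • y + t ^ 2 • w) =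
      C x x + 2 * t * C x y + t ^ 2 * (C y y + 2 * C x w) + 2 * t ^ 3 * C y w
        + t ^ 4 * C w w := by
  simp only [map_add, map_smul, LinearMap.add_apply, LinearMap.smul_apply, smul_eq_mul]
  rw [hC y x, hC w x, hC w y]
  ring

/-- Through a common zero `x` of `A` and `B` with independent differentials there is a curve of
common zeros in each tangent direction `y`. -/
lemma exists_curve_of_zeros (A B : LinearMap.BilinForm ℝ V)
    (hA : ∀ x y, A x y = A y x) (hB : ∀ x y, B x y = B y x) {x e f y : V}
    (hAx : A x x = 0) (hBx : B x x = 0) (hef : A x e * B x f - A x f * B x e ≠ 0)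
    (hAy : A x y = 0) (hBy : B x y = 0) :
    ∃ (a b : ℝ → ℝ) (a₀ b₀ : ℝ), Tendsto a (𝓝[≠] 0) (𝓝 a₀) ∧ Tendsto b (𝓝[≠] 0) (𝓝 b₀) ∧
      ∀ᶠ t in 𝓝[≠] (0 : ℝ),
        A (x + t • y + t ^ 2 • (a t • e + b t • f)) (x + t • y + t ^ 2 • (a t • e + b t • f)) = 0 ∧
        B (x + t • y + t ^ 2 • (a t • e + b t • f)) (x + t • y + t ^ 2 • (a t • e + b t • f)) = 0 := by
  let G : LinearMap.BilinForm ℝ V → ℝ × (ℝ × ℝ) → ℝ := fun C p =>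
    C y y + 2 * (p.2.1 * C x e + p.2.2 * C x f) + 2 * p.1 * (p.2.1 * C y e + p.2.2 * C y f)
      + p.1 ^ 2 * (p.2.1 ^ 2 * C e e + 2 * p.2.1 * p.2.2 * C e f + p.2.2 ^ 2 * C f f)
  let φ : LinearMap.BilinForm ℝ V → ℝ × ℝ →L[ℝ] ℝ := fun C =>
    (2 * C x e) • ContinuousLinearMap.fst ℝ ℝ ℝ + (2 * C x f) • ContinuousLinearMap.snd ℝ ℝ ℝ
  obtain ⟨z, z₀, hz, hev⟩ := exists_zero_curve_of_contDiff (fun p => (G A p, G B p))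
    (by simp only [G]; fun_prop) ((φ A).prod (φ B))
    (by
      rw [injective_iff_map_eq_zero]
      rintro ⟨a, b⟩ h
      simp only [φ, ContinuousLinearMap.prod_apply, _root_.add_apply,
        _root_.smul_apply, ContinuousLinearMap.coe_fst', ContinuousLinearMap.coe_snd',
        smul_eq_mul, Prod.mk_eq_zero] at h
      obtain ⟨h1, h2⟩ := h
      rw [Prod.mk_eq_zero]
      constructor
      · exact (mul_eq_zero.mp (show (A x e * B x f - A x f * B x e) * a = 0 by
          linear_combination B x f / 2 * h1 - A x f / 2 * h2)).resolve_left hef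
      · exact (mul_eq_zero.mp (show (A x e * B x f - A x f * B x e) * b = 0 by
          linear_combination A x e / 2 * h2 - B x e / 2 * h1)).resolve_left hef)
    (A y y, B y y)
    (by
      rintro ⟨a, b⟩
      simp only [G, φ, ContinuousLinearMap.prod_apply, _root_.add_apply,
        _root_.smul_apply, ContinuousLinearMap.coe_fst', ContinuousLinearMap.coe_snd',
        smul_eq_mul, Prod.mk_add_mk, Prod.mk.injEq]
      constructor <;> ring)
  have hC : ∀ C : LinearMap.BilinForm ℝ V, (∀ x y, C x y = C y x) → C x x = 0 → C x y = 0 →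
      ∀ (t a b : ℝ), G C (t, (a, b)) = 0 →
        C (x + t • y + t ^ 2 • (a • e + b • f)) (x + t • y + t ^ 2 • (a • e + b • f)) = 0 := by
    intro C hC hx hy t a b h
    rw [bilin_add_smul_add_smul C hC, hx, hy, bilin_smul_add_smul C hC]
    simp only [G] at h
    simp only [map_add, map_smul, smul_eq_mul]
    linear_combination t ^ 2 * h
  refine ⟨fun t => (z t).1, fun t => (z t).2, z₀.1, z₀.2,
    ((continuous_fst.tendsto z₀).comp hz).mono_left nhdsWithin_le_nhds,
    ((continuous_snd.tendsto z₀).comp hz).mono_left nhdsWithin_le_nhds, ?_⟩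
  filter_upwards [hev.filter_mono nhdsWithin_le_nhds] with t ht
  rw [Prod.mk_eq_zero] at ht
  exact ⟨hC A hA hAx hAy t _ _ ht.1, hC B hB hBx hBy t _ _ ht.2⟩

lemma eq_zero_of_tendsto_mul_id {r : ℝ} {g : ℝ → ℝ} {l : ℝ} (hg : Tendsto g (𝓝[≠] 0) (𝓝 l))
    (h : ∀ᶠ t in 𝓝[≠] (0 : ℝ), r + t * g t = 0) : r = 0 := by
  have h1 : Tendsto (fun t : ℝ => r + t * g t) (𝓝[≠] 0) (𝓝 (r + 0 * l)) :=
    ((tendsto_id.mono_left nhdsWithin_le_nhds).mul hg).const_add r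
  have h2 := tendsto_nhds_unique h1 (tendsto_const_nhds.congr' (h.mono fun t ht => ht.symm))
  linarith

lemma exists_eq_mul_add_mul_of_ker_inf_le (φ ψ χ : V →ₗ[ℝ] ℝ)
    (h : ∀ y, φ y = 0 → ψ y = 0 → χ y = 0) : ∃ r s : ℝ, ∀ y, χ y = r * φ y + s * ψ y := by
  have h2 : χ ∈ Submodule.span ℝ (Set.range ![φ, ψ]) := by
    apply mem_span_of_iInf_ker_le_ker
    intro y hy
    simp only [Submodule.mem_iInf, LinearMap.mem_ker] at hy ⊢
    exact h y (hy 0) (hy 1)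
  rw [Matrix.range_cons, Matrix.range_cons, Matrix.range_empty, Set.union_empty,
    Set.singleton_union, Submodule.mem_span_pair] at h2
  obtain ⟨r, s, hrs⟩ := h2
  exact ⟨r, s, fun p => by rw [← hrs]; simp⟩

/-- At a common zero with independent differentials, a form vanishing on all common zeros has
differential in the span of the two differentials, and the corresponding combination vanishes on
the tangent space. -/
lemma exists_multipliers (A B C : LinearMap.BilinForm ℝ V)
    (hA : ∀ x y, A x y = A y x) (hB : ∀ x y, B x y = B y x) (hC : ∀ x y, C x y = C y x)
    (hZ : ∀ x, A x x = 0 → B x x = 0 → C x x = 0) {x e f : V}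
    (hAx : A x x = 0) (hBx : B x x = 0) (hef : A x e * B x f - A x f * B x e ≠ 0) :
    ∃ r s : ℝ, (∀ p, C x p = r * A x p + s * B x p) ∧
      ∀ y, A x y = 0 → B x y = 0 → C y y = r * A y y + s * B y y := by
  have h1 : ∀ y, A x y = 0 → B x y = 0 → C x y = 0 := by
    intro y hAy hBy
    obtain ⟨a, b, a₀, b₀, ha, hb, hev⟩ := exists_curve_of_zeros A B hA hB hAx hBx hef hAy hBy
    have hg : Tendsto (fun t => C y y + 2 * (a t * C x e + b t * C x f)
        + 2 * t * (a t * C y e + b t * C y f)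
        + t ^ 2 * (a t ^ 2 * C e e + 2 * a t * b t * C e f + b t ^ 2 * C f f)) (𝓝[≠] 0) (𝓝 _) :=
      (((((ha.mul_const _).add (hb.mul_const _)).const_mul 2).const_add _).add
        (((tendsto_id.mono_left nhdsWithin_le_nhds).const_mul 2).mul
          ((ha.mul_const _).add (hb.mul_const _)))).add
        (((tendsto_id.mono_left nhdsWithin_le_nhds).pow 2).mul
          ((((ha.pow 2).mul_const _).add (((ha.const_mul 2).mul hb).mul_const _)).add
            ((hb.pow 2).mul_const _)))
    have h2 : 2 * C x y = 0 := by
      refine eq_zero_of_tendsto_mul_id hg ?_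
      filter_upwards [hev, self_mem_nhdsWithin] with t ht ht0
      have h3 := hZ _ ht.1 ht.2
      rw [bilin_add_smul_add_smul C hC, hZ x hAx hBx, bilin_smul_add_smul C hC] at h3
      simp only [map_add, map_smul, smul_eq_mul] at h3
      refine (mul_eq_zero.mp (?_ : t * _ = 0)).resolve_left ht0
      linear_combination h3
    linarith
  obtain ⟨r, s, h3⟩ := exists_eq_mul_add_mul_of_ker_inf_le (A x) (B x) (C x) h1
  refine ⟨r, s, h3, fun y hAy hBy => ?_⟩
  obtain ⟨a, b, a₀, b₀, ha, hb, hev⟩ := exists_curve_of_zeros A B hA hB hAx hBx hef hAy hBy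
  set D := C - r • A - s • B with hD
  have hDs : ∀ x y, D x y = D y x := fun p q => by simp [hD, hA p q, hB p q, hC p q]
  have hDx : ∀ p, D x p = 0 := fun p => by simp [hD, h3]
  have hg : Tendsto (fun t => 2 * (a t * D y e + b t * D y f)
      + t * (a t ^ 2 * D e e + 2 * a t * b t * D e f + b t ^ 2 * D f f)) (𝓝[≠] 0) (𝓝 _) :=
    (((ha.mul_const _).add (hb.mul_const _)).const_mul 2).add
      ((tendsto_id.mono_left nhdsWithin_le_nhds).mul
        ((((ha.pow 2).mul_const _).add (((ha.const_mul 2).mul hb).mul_const _)).add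
          ((hb.pow 2).mul_const _)))
  have h4 : D y y = 0 := by
    refine eq_zero_of_tendsto_mul_id hg ?_
    filter_upwards [hev, self_mem_nhdsWithin] with t ht ht0
    have h5 : D (x + t • y + t ^ 2 • (a t • e + b t • f))
        (x + t • y + t ^ 2 • (a t • e + b t • f)) = 0 := by
      rw [hD]
      simp only [LinearMap.sub_apply, LinearMap.smul_apply, ht.1, ht.2, hZ _ ht.1 ht.2]
      simp
    rw [bilin_add_smul_add_smul D hDs, hDx, hDx, hDx, bilin_smul_add_smul D hDs] at h5
    simp only [map_add, map_smul, smul_eq_mul] at h5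
    refine (mul_eq_zero.mp (?_ : t ^ 2 * _ = 0)).resolve_left (pow_ne_zero 2 ht0)
    linear_combination h5
  simp only [hD, LinearMap.sub_apply, LinearMap.smul_apply, smul_eq_mul] at h4
  linarith

end RegularZeros

section LargeRank

variable {V : Type*} [AddCommGroup V] [Module ℝ V]

/-- If a nonzero form `D` annihilates all common zeros of `A` and `B` with independent
differentials, then at each of them `D` annihilates the tangent space and some nonzero combination
of `A` and `B` vanishes on it. -/
lemma exists_combination_zero_on_tangent (A B D : LinearMap.BilinForm ℝ V)
    (hA : ∀ x y, A x y = A y x) (hB : ∀ x y, B x y = B y x) (hD : ∀ x y, D x y = D y x)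
    (hD0 : D ≠ 0)
    (hreg : ∀ x e f, A x x = 0 → B x x = 0 → A x e * B x f - A x f * B x e ≠ 0 → D x = 0)
    {x e f : V} (hAx : A x x = 0) (hBx : B x x = 0)
    (hef : A x e * B x f - A x f * B x e ≠ 0) :
    (∀ y, A x y = 0 → B x y = 0 → D y = 0) ∧
      ∃ a b : ℝ, (a ≠ 0 ∨ b ≠ 0) ∧ ∀ y, A x y = 0 → B x y = 0 → a * A y y + b * B y y = 0 := by
  have hcurve : ∀ y, A x y = 0 → B x y = 0 → D y = 0 ∧
      ∃ (α β : ℝ → ℝ) (a₀ b₀ : ℝ), Tendsto α (𝓝[≠] 0) (𝓝 a₀) ∧ Tendsto β (𝓝[≠] 0) (𝓝 b₀) ∧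
      ∀ᶠ t in 𝓝[≠] (0 : ℝ), D (α t • e + β t • f) = 0 ∧
        A (x + t • y + t ^ 2 • (α t • e + β t • f)) (x + t • y + t ^ 2 • (α t • e + β t • f)) = 0 ∧
        B (x + t • y + t ^ 2 • (α t • e + β t • f))
          (x + t • y + t ^ 2 • (α t • e + β t • f)) = 0 := by
    intro y hAy hBy
    obtain ⟨a, b, a₀, b₀, ha, hb, hev⟩ := exists_curve_of_zeros A B hA hB hAx hBx hef hAy hBy
    have hid : Tendsto (fun t : ℝ => t) (𝓝[≠] 0) (𝓝 0) := tendsto_id.mono_left nhdsWithin_le_nhds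
    have hlim : ∀ (C : LinearMap.BilinForm ℝ V) (p : V),
        Tendsto (fun t => C (x + t • y + t ^ 2 • (a t • e + b t • f)) p) (𝓝[≠] 0)
          (𝓝 (C x p)) := by
      intro C p
      have h1 : Tendsto (fun t => C x p + t * C y p + t ^ 2 * (a t * C e p + b t * C f p))
          (𝓝[≠] 0) (𝓝 (C x p + 0 * C y p + 0 ^ 2 * (a₀ * C e p + b₀ * C f p))) :=
        ((hid.mul_const _).const_add _).add
          ((hid.pow 2).mul ((ha.mul_const _).add (hb.mul_const _)))
      have h2 : C x p + 0 * C y p + 0 ^ 2 * (a₀ * C e p + b₀ * C f p) = C x p := by ring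
      rw [h2] at h1
      simpa only [map_add, map_smul, LinearMap.add_apply, LinearMap.smul_apply, smul_eq_mul]
        using h1
    have hdet := (((hlim A e).mul (hlim B f)).sub ((hlim A f).mul (hlim B e))).eventually_ne hef
    have hDz : ∀ᶠ t in 𝓝[≠] (0 : ℝ), D (x + t • y + t ^ 2 • (a t • e + b t • f)) = 0 := by
      filter_upwards [hev, hdet] with t ht ht'
      exact hreg _ e f ht.1 ht.2 ht'
    have hDx : D x = 0 := hreg x e f hAx hBx hef
    have hDy : D y = 0 := by
      ext p
      refine eq_zero_of_tendsto_mul_id (g := fun t => a t * D e p + b t * D f p)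
        ((ha.mul_const _).add (hb.mul_const _)) ?_
      filter_upwards [hDz, self_mem_nhdsWithin] with t ht ht0
      have h1 := LinearMap.congr_fun ht p
      simp only [map_add, map_smul, LinearMap.add_apply, LinearMap.smul_apply, smul_eq_mul, hDx,
        LinearMap.zero_apply] at h1
      refine (mul_eq_zero.mp (?_ : t * _ = 0)).resolve_left ht0
      linear_combination h1
    refine ⟨hDy, a, b, a₀, b₀, ha, hb, ?_⟩
    filter_upwards [hDz, hev, self_mem_nhdsWithin] with t ht ht' ht0
    refine ⟨?_, ht'⟩
    rw [map_add, map_add, map_smul, map_smul, hDx, hDy, smul_zero, add_zero, zero_add] at ht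
    exact (smul_eq_zero.mp ht).resolve_left (pow_ne_zero 2 ht0)
  refine ⟨fun y hAy hBy => (hcurve y hAy hBy).1, ?_⟩
  obtain ⟨p, hp⟩ : ∃ p, D p ≠ 0 := by
    by_contra! hcon
    exact hD0 (LinearMap.ext hcon)
  obtain ⟨a, b, hab⟩ := exists_eq_mul_add_mul_of_ker_inf_le (A x) (B x) (D p)
    (fun y hAy hBy => by rw [hD p y, (hcurve y hAy hBy).1]; rfl)
  refine ⟨a, b, ?_, fun y hAy hBy => ?_⟩
  · by_contra! hcon
    apply hp
    ext q
    rw [hab, hcon.1, hcon.2]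
    simp
  · obtain ⟨-, α, β, a₀, b₀, hα, hβ, hev⟩ := hcurve y hAy hBy
    set F := a • A + b • B with hF
    have hFs : ∀ p q, F p q = F q p := fun p q => by simp [hF, hA p q, hB p q]
    have hFx : ∀ q, F x q = D p q := fun q => by simp [hF, hab]
    have hg : Tendsto (fun t => 2 * (α t * F y e + β t * F y f)
        + t * (α t ^ 2 * F e e + 2 * α t * β t * F e f + β t ^ 2 * F f f)) (𝓝[≠] 0) (𝓝 _) :=
      (((hα.mul_const _).add (hβ.mul_const _)).const_mul 2).add
        ((tendsto_id.mono_left nhdsWithin_le_nhds).mul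
          ((((hα.pow 2).mul_const _).add (((hα.const_mul 2).mul hβ).mul_const _)).add
            ((hβ.pow 2).mul_const _)))
    have h1 : F y y = 0 := by
      refine eq_zero_of_tendsto_mul_id hg ?_
      filter_upwards [hev, self_mem_nhdsWithin] with t ht ht0
      have h2 : F (x + t • y + t ^ 2 • (α t • e + β t • f))
          (x + t • y + t ^ 2 • (α t • e + β t • f)) = 0 := by
        rw [hF]
        simp only [LinearMap.add_apply, LinearMap.smul_apply, ht.2.1, ht.2.2]
        simp
      have h3 : F x (α t • e + β t • f) = 0 := by rw [hFx, hD, ht.1]; rfl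
      have h4 : F x y = 0 := by simp [hF, hAy, hBy]
      have h5 : F x x = 0 := by simp [hF, hAx, hBx]
      rw [bilin_add_smul_add_smul F hFs, h3, h4, h5, bilin_smul_add_smul F hFs] at h2
      simp only [map_add, map_smul, smul_eq_mul] at h2
      refine (mul_eq_zero.mp (?_ : t ^ 2 * _ = 0)).resolve_left (pow_ne_zero 2 ht0)
      linear_combination h2
    simpa [hF] using h1

variable [FiniteDimensional ℝ V]

/-- If `F` and `D` are both trivial along a direction `k` with `G k k ≠ 0`, and `D` vanishes on the
common zeros of the nondissipative pair `F, G` with `F` of rank at least three, then `D` is a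
multiple of `F`. -/
lemma exists_eq_mul_of_common_ker (F G D : LinearMap.BilinForm ℝ V)
    (hF : ∀ x y, F x y = F y x) (hG : ∀ x y, G x y = G y x) (hD : ∀ x y, D x y = D y x)
    (hnd : IsNondissipative F G) (hF1 : NonvanishingOnCodim F 1)
    (hZ : ∀ x, F x x = 0 → G x x = 0 → D x x = 0) {k : V} (hFk : F k = 0) (hDk : D k = 0)
    (hGk : G k k ≠ 0) : ∃ c : ℝ, ∀ x, D x x = c * F x x := by
  wlog hpos : 0 < G k k generalizing G
  · refine this (-G) (fun x y => by simp [hG x y]) hnd.neg_right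
      (fun x hx hx' => hZ x hx (by simpa using hx')) (by simpa using hGk) ?_
    simp only [LinearMap.neg_apply]
    rcases lt_or_gt_of_ne hGk with h | h
    · linarith
    · exact absurd h hpos
  obtain ⟨w, hw, hGw⟩ := hnd.exists_isotropic_neg hF hG
  obtain ⟨u, hu⟩ := hnd.exists_pos
  obtain ⟨v, hv⟩ := hnd.exists_neg
  refine exists_eq_mul_of_zero_on_quadric F D hF hD hu hv
    (zero_on_quadric_of_zero_on_negative_part F G D hF hG hD hu hv hF1 hw hGw fun y hy hGy => ?_)
  obtain ⟨r, -, -, -, hr, -⟩ := exists_roots_of_opposite_signs (G k k) (G y k) (G y y) hpos hGy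
  have h1 := hZ (y + r • k)
    (by rw [bilin_add_smul F hF, hF y k, hFk, hy]; simp)
    (by rw [bilin_add_smul G hG]; linear_combination hr)
  rw [bilin_add_smul D hD, hD y k, hDk] at h1
  simpa using h1

/-- If the nondissipative pair `A, B` contains a form of rank at least `17` and all its nonzero
combinations have rank at least three, then a quadratic form vanishing on the common zeros of `A`
and `B` is a combination of `A` and `B`. -/
theorem exists_eq_combination_of_zero_on_common_zeros (A B C : LinearMap.BilinForm ℝ V)
    (hA : ∀ x y, A x y = A y x) (hB : ∀ x y, B x y = B y x) (hC : ∀ x y, C x y = C y x)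
    (hnd : IsNondissipative A B) (hA8 : NonvanishingOnCodim A 8)
    (hmin : ∀ a b : ℝ, (a ≠ 0 ∨ b ≠ 0) → NonvanishingOnCodim (a • A + b • B) 1)
    (hZ : ∀ x, A x x = 0 → B x x = 0 → C x x = 0) :
    ∃ r s : ℝ, ∀ x, C x x = r * A x x + s * B x x := by
  by_contra! hcon
  obtain ⟨x, e, f, hAx, hBx, hef⟩ := exists_regular_zero A B hA hB (hA8.mono (by norm_num)) hnd
  have hT : ∀ x, finrank ℝ V ≤
      finrank ℝ (LinearMap.ker (A x) ⊓ LinearMap.ker (B x) : Submodule ℝ V) + (1 + 1) := fun x =>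
    finrank_le_finrank_inf_add (finrank_le_finrank_ker_add_one _)
      (finrank_le_finrank_ker_add_one _)
  have hDs : ∀ r s : ℝ, ∀ p q, (C - r • A - s • B) p q = (C - r • A - s • B) q p :=
    fun r s p q => by simp [hA p q, hB p q, hC p q]
  have main : ∀ (a b r s : ℝ) (K : Submodule ℝ V), (a ≠ 0 ∨ b ≠ 0) →
      finrank ℝ V ≤ finrank ℝ K + 8 → (∀ k ∈ K, (a • A + b • B) k = 0) →
      (∀ k ∈ K, (C - r • A - s • B) k = 0) → False := by
    intro a b r s K hab hK hFK hDK
    obtain ⟨k, hk, hAk⟩ := hA8 K hK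
    have hFk := hFK k hk
    have hb : b ≠ 0 := by
      rintro rfl
      have h1 := LinearMap.congr_fun hFk k
      simp only [zero_smul, add_zero, LinearMap.smul_apply, smul_eq_mul,
        LinearMap.zero_apply] at h1
      rcases mul_eq_zero.mp h1 with h1 | h1
      · simp [h1] at hab
      · exact hAk h1
    have hnd' := hnd.smul_add_smul a b 1 0 (by simpa using hb)
    rw [one_smul, zero_smul, add_zero] at hnd'
    obtain ⟨c, hc⟩ := exists_eq_mul_of_common_ker (a • A + b • B) A (C - r • A - s • B)
      (fun p q => by simp [hA p q, hB p q]) hA (hDs r s) hnd' (hmin a b hab)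
      (fun p hp hAp => by
        have hBp : B p p = 0 := by simpa [hAp, hb] using hp
        simp [hAp, hBp, hZ p hAp hBp]) hFk (hDK k hk) hAk
    obtain ⟨p, hp⟩ := hcon (r + c * a) (s + c * b)
    apply hp
    have h1 := hc p
    simp only [LinearMap.add_apply, LinearMap.sub_apply, LinearMap.smul_apply, smul_eq_mul] at h1
    linear_combination h1
  obtain ⟨r, s, hrs, hTx⟩ := exists_multipliers A B C hA hB hC hZ hAx hBx hef
  by_cases hreg : ∀ x e f, A x x = 0 → B x x = 0 → A x e * B x f - A x f * B x e ≠ 0 →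
      (C - r • A - s • B) x = 0
  · have hD0 : C - r • A - s • B ≠ 0 := by
      intro h0
      obtain ⟨p, hp⟩ := hcon r s
      have h1 := LinearMap.congr_fun (LinearMap.congr_fun h0 p) p
      simp only [LinearMap.sub_apply, LinearMap.smul_apply, smul_eq_mul,
        LinearMap.zero_apply] at h1
      exact hp (by linarith)
    obtain ⟨hDT, a, b, hab, hF⟩ := exists_combination_zero_on_tangent A B (C - r • A - s • B)
      hA hB (hDs r s) hD0 hreg hAx hBx hef
    have h1 := finrank_le_finrank_ker_add_of_zero_on (a • A + b • B)
      (fun p q => by simp [hA p q, hB p q]) _ _ (hT x)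
      (fun y hy => by simpa using hF y hy.1 hy.2)
    have h2 := finrank_le_finrank_inf_add (hT x) h1
    exact main a b r s
      (LinearMap.ker (A x) ⊓ LinearMap.ker (B x) ⊓ LinearMap.ker (a • A + b • B)) hab (h2.trans (by omega)) (fun k hk => hk.2)
      (fun k hk => hDT k hk.1.1 hk.1.2)
  · push Not at hreg
    obtain ⟨x', e', f', hAx', hBx', hef', hDx'⟩ := hreg
    obtain ⟨r', s', hrs', hTx'⟩ := exists_multipliers A B C hA hB hC hZ hAx' hBx' hef'
    have h1 := finrank_le_finrank_ker_add_of_zero_on (C - r • A - s • B) (hDs r s) _ _ (hT x)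
      (fun y hy => by simp [hTx y hy.1 hy.2])
    have h2 := finrank_le_finrank_ker_add_of_zero_on (C - r' • A - s' • B) (hDs r' s') _ _ (hT x')
      (fun y hy => by simp [hTx' y hy.1 hy.2])
    have h3 := finrank_le_finrank_inf_add h1 h2
    refine main (r' - r) (s' - s) r s
      (LinearMap.ker (C - r • A - s • B) ⊓ LinearMap.ker (C - r' • A - s' • B)) ?_ (h3.trans (by omega)) (fun k hk => ?_)
      (fun k hk => hk.1)
    · by_contra! h0
      apply hDx'
      ext p
      have hr : r' = r := by linarith [h0.1]
      have hs : s' = s := by linarith [h0.2]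
      simp [hrs', hr, hs]
    · have h4 : (C - r • A - s • B) k = 0 := hk.1
      have h5 : (C - r' • A - s' • B) k = 0 := hk.2
      ext p
      have h6 := LinearMap.congr_fun h4 p
      have h7 := LinearMap.congr_fun h5 p
      simp only [LinearMap.add_apply, LinearMap.sub_apply, LinearMap.smul_apply, smul_eq_mul,
        LinearMap.zero_apply] at h6 h7 ⊢
      linear_combination h6 - h7

end LargeRank

section RankTwo

variable {V : Type*} [AddCommGroup V] [Module ℝ V]

/-- An indefinite form of rank two is the symmetric product of two independent linear forms. -/
lemma exists_factorization_of_finrank_range_le_two [FiniteDimensional ℝ V]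
    (F : LinearMap.BilinForm ℝ V) (hF : ∀ x y, F x y = F y x)
    (hr : finrank ℝ (LinearMap.range F) ≤ 2) {u v : V} (hu : 0 < F u u) (hv : F v v < 0) :
    ∃ w w' : V, ∃ c : ℝ, c ≠ 0 ∧ F w w = 0 ∧ F w' w' = 0 ∧ F w w' = c ∧
      ∀ x y, c * F x y = F w x * F w' y + F w' x * F w y := by
  obtain ⟨r, s, hr0, hs0, er, es, ers⟩ := exists_roots_of_opposite_signs (F u u) (F u v) (F v v)
    hu hv
  have e1 : F (v + r • u) (v + r • u) = 0 := by
    rw [bilin_add_smul F hF, hF v u]; linear_combination er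
  have e2 : F (v + s • u) (v + s • u) = 0 := by
    rw [bilin_add_smul F hF, hF v u]; linear_combination es
  have e3 : F (v + r • u) (v + s • u) ≠ 0 := by
    intro h0
    have h1 : F (v + r • u - (v + s • u)) (v + r • u - (v + s • u)) = 0 := by
      have h2 : ∀ p q, F (p - q) (p - q) = F p p - 2 * F p q + F q q := fun p q => by
        rw [map_sub F, LinearMap.sub_apply, map_sub, map_sub, hF q p]; ring
      rw [h2, e1, e2, h0]; ring
    have h2 : v + r • u - (v + s • u) = (r - s) • u := by module
    rw [h2] at h1
    simp only [map_smul, LinearMap.smul_apply, smul_eq_mul] at h1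
    have h3 : (r - s) * (r - s) * F u u = 0 := by linear_combination h1
    have h4 : 0 < (r - s) * (r - s) := mul_pos_of_neg_of_neg (by linarith) (by linarith)
    exact (mul_pos h4 hu).ne' h3
  generalize v + r • u = w at *
  generalize v + s • u = w' at *
  refine ⟨w, w', F w w', e3, e1, e2, rfl, fun x y => ?_⟩
  have hker : finrank ℝ V ≤ finrank ℝ (LinearMap.ker F) + 2 := by
    have := LinearMap.finrank_range_add_finrank_ker F
    omega
  have hle : LinearMap.ker F ≤ LinearMap.ker (F w) ⊓ LinearMap.ker (F w') := by
    intro z hz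
    rw [LinearMap.mem_ker] at hz
    rw [Submodule.mem_inf, LinearMap.mem_ker, LinearMap.mem_ker, hF w, hF w', hz]
    simp
  have heq : LinearMap.ker F = LinearMap.ker (F w) ⊓ LinearMap.ker (F w') := by
    apply Submodule.eq_of_le_of_finrank_le hle
    have hli : LinearIndependent ℝ ![w, w'] := by
      rw [LinearIndependent.pair_iff]
      intro a b hab
      have h1 := congrArg (F w) hab
      have h2 := congrArg (F w') hab
      simp only [map_add, map_smul, smul_eq_mul, map_zero, e1, e2, hF w' w] at h1 h2
      constructor
      · exact (mul_eq_zero.mp (by linarith : a * F w w' = 0)).resolve_right e3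
      · exact (mul_eq_zero.mp (by linarith : b * F w w' = 0)).resolve_right e3
    have hW : finrank ℝ (Submodule.span ℝ (Set.range ![w, w'])) = 2 := by
      rw [finrank_span_eq_card hli]; simp
    have hdis : Submodule.span ℝ (Set.range ![w, w']) ⊓
        (LinearMap.ker (F w) ⊓ LinearMap.ker (F w')) = ⊥ := by
      rw [eq_bot_iff]
      rintro z ⟨hz1, hz2, hz3⟩
      rw [SetLike.mem_coe, Matrix.range_cons, Matrix.range_cons, Matrix.range_empty,
        Set.union_empty, Set.singleton_union, Submodule.mem_span_pair] at hz1
      obtain ⟨a, b, rfl⟩ := hz1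
      rw [SetLike.mem_coe, LinearMap.mem_ker] at hz2 hz3
      simp only [map_add, map_smul, smul_eq_mul, e1, e2, hF w' w] at hz2 hz3
      have ha : a = 0 := (mul_eq_zero.mp (by linarith : a * F w w' = 0)).resolve_right e3
      have hb : b = 0 := (mul_eq_zero.mp (by linarith : b * F w w' = 0)).resolve_right e3
      simp [ha, hb]
    have h1 := Submodule.finrank_sup_add_finrank_inf_eq (Submodule.span ℝ (Set.range ![w, w']))
      (LinearMap.ker (F w) ⊓ LinearMap.ker (F w'))
    have h2 := Submodule.finrank_le (Submodule.span ℝ (Set.range ![w, w']) ⊔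
      (LinearMap.ker (F w) ⊓ LinearMap.ker (F w')))
    rw [hdis, finrank_bot, hW] at h1
    omega
  have hz : F w w' • x - F w' x • w - F w x • w' ∈ LinearMap.ker F := by
    rw [heq, Submodule.mem_inf, LinearMap.mem_ker, LinearMap.mem_ker]
    simp only [map_sub, map_smul, smul_eq_mul, e1, e2, hF w' w]
    constructor <;> ring
  have h1 := LinearMap.congr_fun (LinearMap.mem_ker.mp hz) y
  simp only [map_sub, map_smul, LinearMap.sub_apply, LinearMap.smul_apply, smul_eq_mul,
    LinearMap.zero_apply] at h1
  linear_combination h1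

lemma exists_apply_eq_mul_of_indefinite_on_ker [FiniteDimensional ℝ V]
    (G : LinearMap.BilinForm ℝ V) (hG : ∀ x y, G x y = G y x) (hG2 : NonvanishingOnCodim G 2)
    (l m : V →ₗ[ℝ] ℝ) {X e f w w' : V} (he : l e = 0) (hme : m e ≠ 0) (hf : l f ≠ 0)
    (hw : l w = 0) (hGw : G w w < 0) (hw' : l w' = 0) (hGw' : 0 < G w' w')
    (h : ∀ x, l x = 0 → G x x = 0 → m x * G x X = 0) :
    ∃ κ : ℝ, ∀ x, G x X = κ * l x := by
  have hK : ∀ x, l x = 0 → m x * G x X = 0 := by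
    obtain ⟨c, hc⟩ := exists_eq_mul_of_zero_on_quadric
      (G.restrict (LinearMap.ker l))
      (LinearMap.BilinForm.restrict (m.smulRight (G X) + (G X).smulRight m) (LinearMap.ker l))
      (fun x y => hG x y)
      (fun x y => by simp [mul_comm, add_comm])
      (u := ⟨w', hw'⟩) (v := ⟨w, hw⟩) hGw' hGw (fun x hx => by
        have := h x x.2 hx
        simp only [LinearMap.BilinForm.restrict_apply, LinearMap.domRestrict_apply,
          LinearMap.add_apply, LinearMap.smulRight_apply, LinearMap.smul_apply, smul_eq_mul,
          hG X x]
        linarith)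
    have hc' : ∀ x, l x = 0 → 2 * (m x * G x X) = c * G x x := by
      intro x hx
      have := hc ⟨x, hx⟩
      simp only [LinearMap.BilinForm.restrict_apply, LinearMap.domRestrict_apply,
        LinearMap.add_apply, LinearMap.smulRight_apply, LinearMap.smul_apply, smul_eq_mul,
        hG X x] at this
      linarith
    obtain ⟨y, hy, hGy⟩ := hG2 (LinearMap.ker l ⊓ LinearMap.ker m)
      (finrank_le_finrank_inf_add (finrank_le_finrank_ker_add_one _)
        (finrank_le_finrank_ker_add_one _))
    have hly : l y = 0 := hy.1
    have hmy : m y = 0 := hy.2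
    have h0 := hc' y hly
    rw [hmy, zero_mul, mul_zero] at h0
    have hc0 : c = 0 := (mul_eq_zero.mp h0.symm).resolve_right hGy
    intro x hx
    have := hc' x hx
    rw [hc0] at this
    linarith
  have hK' : ∀ x, l x = 0 → G x X = 0 := by
    intro x hx
    by_cases hmx : m x = 0
    · have h1 := (mul_eq_zero.mp (hK e he)).resolve_left hme
      have h2 := (mul_eq_zero.mp (hK (x + e) (by simp [hx, he]))).resolve_left
        (by simpa [hmx] using hme)
      simpa [h1] using h2
    · exact (mul_eq_zero.mp (hK x hx)).resolve_left hmx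
  refine ⟨G f X / l f, fun x => ?_⟩
  have h1 := hK' (l f • x - l x • f) (by simp [mul_comm])
  simp only [map_sub, map_smul, LinearMap.sub_apply, LinearMap.smul_apply, smul_eq_mul] at h1
  field_simp
  linear_combination h1

lemma false_of_nonneg_on_ker (G : LinearMap.BilinForm ℝ V) (hG : ∀ x y, G x y = G y x)
    (l m : V →ₗ[ℝ] ℝ) {X f w : V} {κ : ℝ} (hX : l X = 0) (hf : m f = 0) (hlf : l f ≠ 0)
    (hw : l w = 0) (hGw : G w w < 0) (hκ : ∀ x, G x X = κ * l x)
    (hrad : m X = 0 → ∃ x, G x X ≠ 0) (hnn : ∀ x, m x = 0 → 0 ≤ G x x) : False := by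
  have hXX : G X X = 0 := by rw [hκ, hX, mul_zero]
  by_cases hmX : m X = 0
  · obtain ⟨x, hx⟩ := hrad hmX
    have hκ0 : κ ≠ 0 := by
      rintro rfl
      rw [hκ, zero_mul] at hx
      exact hx rfl
    have h1 := hnn (f + (-(G f f + 1) / (2 * (κ * l f))) • X) (by simp [hf, hmX])
    rw [bilin_add_smul G hG, hXX, hκ] at h1
    have h2 : 2 * (-(G f f + 1) / (2 * (κ * l f))) * (κ * l f) = -(G f f + 1) := by
      field_simp
    linarith
  · have h1 := hnn (w + (-m w / m X) • X) (by simp [hmX])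
    rw [bilin_add_smul G hG, hXX, hκ, hw] at h1
    linarith

/-- The rank-two case: if `m x * G x X + l x * G x Y` vanishes on the common zeros of `l * m`
and `G`, then it is a multiple of `l * m`. -/
lemma exists_eq_mul_of_zero_on_product [FiniteDimensional ℝ V]
    (G : LinearMap.BilinForm ℝ V) (hG : ∀ x y, G x y = G y x) (hG2 : NonvanishingOnCodim G 2)
    (l m : V →ₗ[ℝ] ℝ) {X Y e f : V} (he : l e = 0) (hme : m e ≠ 0) (hf : m f = 0)
    (hlf : l f ≠ 0) (hX : l X = 0) (hY : m Y = 0)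
    (hXr : m X = 0 → ∃ x, G x X ≠ 0) (hYr : l Y = 0 → ∃ x, G x Y ≠ 0)
    (hneg : ∃ w, l w * m w = 0 ∧ G w w < 0) (hpos : ∃ w, l w * m w = 0 ∧ 0 < G w w)
    (h : ∀ x, l x * m x = 0 → G x x = 0 → m x * G x X + l x * G x Y = 0) :
    ∃ κ : ℝ, ∀ x, m x * G x X + l x * G x Y = κ * (l x * m x) := by
  have hNG : ∀ x y, (-G) x y = (-G) y x := fun x y => by simp [hG x y]
  have hl : (∃ w, l w = 0 ∧ G w w < 0) → (∃ w, l w = 0 ∧ 0 < G w w) →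
      ∃ κ : ℝ, ∀ x, G x X = κ * l x := by
    rintro ⟨w, hw, hGw⟩ ⟨w', hw', hGw'⟩
    refine exists_apply_eq_mul_of_indefinite_on_ker G hG hG2 l m he hme hlf hw hGw hw' hGw'
      fun x hx hGx => ?_
    have := h x (by simp [hx]) hGx
    simpa [hx] using this
  have hm : (∃ w, m w = 0 ∧ G w w < 0) → (∃ w, m w = 0 ∧ 0 < G w w) →
      ∃ κ : ℝ, ∀ x, G x Y = κ * m x := by
    rintro ⟨w, hw, hGw⟩ ⟨w', hw', hGw'⟩
    refine exists_apply_eq_mul_of_indefinite_on_ker G hG hG2 m l hf hlf hme hw hGw hw' hGw'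
      fun x hx hGx => ?_
    have := h x (by simp [hx]) hGx
    simpa [hx] using this
  have hlneg : ∀ w κ, l w = 0 → G w w < 0 → (∀ x, G x X = κ * l x) → ∃ w, m w = 0 ∧ G w w < 0 := by
    intro w κ hw hGw hκ
    by_contra! hcon
    exact false_of_nonneg_on_ker G hG l m hX hf hlf hw hGw hκ hXr hcon
  have hlpos : ∀ w κ, l w = 0 → 0 < G w w → (∀ x, G x X = κ * l x) → ∃ w, m w = 0 ∧ 0 < G w w := by
    intro w κ hw hGw hκ
    by_contra! hcon
    exact false_of_nonneg_on_ker (-G) hNG l m (κ := -κ) hX hf hlf hw (by simpa using hGw)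
      (fun x => by simp [hκ]) (by simpa using hXr) (by simpa using hcon)
  have hmneg : ∀ w κ, m w = 0 → G w w < 0 → (∀ x, G x Y = κ * m x) → ∃ w, l w = 0 ∧ G w w < 0 := by
    intro w κ hw hGw hκ
    by_contra! hcon
    exact false_of_nonneg_on_ker G hG m l hY he hme hw hGw hκ hYr hcon
  have hmpos : ∀ w κ, m w = 0 → 0 < G w w → (∀ x, G x Y = κ * m x) → ∃ w, l w = 0 ∧ 0 < G w w := by
    intro w κ hw hGw hκ
    by_contra! hcon
    exact false_of_nonneg_on_ker (-G) hNG m l (κ := -κ) hY he hme hw (by simpa using hGw)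
      (fun x => by simp [hκ]) (by simpa using hYr) (by simpa using hcon)
  obtain ⟨y, hy, hGy⟩ := hG2 (LinearMap.ker l ⊓ LinearMap.ker m)
    (finrank_le_finrank_inf_add (finrank_le_finrank_ker_add_one _)
      (finrank_le_finrank_ker_add_one _))
  have hly : l y = 0 := hy.1
  have hmy : m y = 0 := hy.2
  have key : (∃ κ : ℝ, ∀ x, G x X = κ * l x) ∧ ∃ κ : ℝ, ∀ x, G x Y = κ * m x := by
    obtain ⟨p, hp, hGp⟩ := hneg
    obtain ⟨q, hq, hGq⟩ := hpos
    have fromL : (∃ w, l w = 0 ∧ G w w < 0) → (∃ w, l w = 0 ∧ 0 < G w w) →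
        (∃ κ : ℝ, ∀ x, G x X = κ * l x) ∧ ∃ κ : ℝ, ∀ x, G x Y = κ * m x := by
      intro hn hp
      obtain ⟨κ, hκ⟩ := hl hn hp
      obtain ⟨a, ha, hGa⟩ := hn
      obtain ⟨b, hb, hGb⟩ := hp
      exact ⟨⟨κ, hκ⟩, hm (hlneg a κ ha hGa hκ) (hlpos b κ hb hGb hκ)⟩
    have fromM : (∃ w, m w = 0 ∧ G w w < 0) → (∃ w, m w = 0 ∧ 0 < G w w) →
        (∃ κ : ℝ, ∀ x, G x X = κ * l x) ∧ ∃ κ : ℝ, ∀ x, G x Y = κ * m x := by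
      intro hn hp
      obtain ⟨κ, hκ⟩ := hm hn hp
      obtain ⟨a, ha, hGa⟩ := hn
      obtain ⟨b, hb, hGb⟩ := hp
      exact ⟨hl (hmneg a κ ha hGa hκ) (hmpos b κ hb hGb hκ), κ, hκ⟩
    rcases mul_eq_zero.mp hp with hp | hp <;> rcases mul_eq_zero.mp hq with hq | hq <;>
      rcases lt_or_gt_of_ne hGy with hGy | hGy
    · exact fromL ⟨p, hp, hGp⟩ ⟨q, hq, hGq⟩
    · exact fromL ⟨p, hp, hGp⟩ ⟨q, hq, hGq⟩
    · exact fromM ⟨y, hmy, hGy⟩ ⟨q, hq, hGq⟩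
    · exact fromL ⟨p, hp, hGp⟩ ⟨y, hly, hGy⟩
    · exact fromL ⟨y, hly, hGy⟩ ⟨q, hq, hGq⟩
    · exact fromM ⟨p, hp, hGp⟩ ⟨y, hmy, hGy⟩
    · exact fromM ⟨p, hp, hGp⟩ ⟨q, hq, hGq⟩
    · exact fromM ⟨p, hp, hGp⟩ ⟨q, hq, hGq⟩
  obtain ⟨⟨κ, hκ⟩, κ', hκ'⟩ := key
  exact ⟨κ + κ', fun x => by rw [hκ, hκ']; ring⟩

end RankTwo

section Matrices

variable {n : Type*} [Fintype n] [DecidableEq n]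

lemma toBilin'_symm {M : Matrix n n ℝ} (hM : M.IsSymm) (x y : n → ℝ) :
    Matrix.toBilin' M x y = Matrix.toBilin' M y x := by
  rw [Matrix.toBilin'_apply', Matrix.toBilin'_apply', Matrix.dotProduct_mulVec,
    ← Matrix.mulVec_transpose, hM.eq, dotProduct_comm]

lemma finrank_range_toBilin' {M : Matrix n n ℝ} (hM : M.IsSymm) :
    finrank ℝ (LinearMap.range (Matrix.toBilin' M)) = M.rank := by
  have hker : LinearMap.ker (Matrix.toBilin' M) = LinearMap.ker M.mulVecLin := by
    ext x
    rw [LinearMap.mem_ker, LinearMap.mem_ker, Matrix.mulVecLin_apply]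
    constructor
    · intro h
      rw [← dotProduct_eq_zero_iff]
      intro y
      rw [dotProduct_comm, ← Matrix.toBilin'_apply', toBilin'_symm hM, h, LinearMap.zero_apply]
    · intro h
      ext y
      rw [LinearMap.comp_apply, LinearMap.comp_apply, toBilin'_symm hM, Matrix.toBilin'_apply', h]
      simp
  have h1 := LinearMap.finrank_range_add_finrank_ker (Matrix.toBilin' M)
  have h2 := LinearMap.finrank_range_add_finrank_ker M.mulVecLin
  rw [hker] at h1
  rw [Matrix.rank]
  omega

lemma eq_zero_of_forall_dotProduct_mulVec {M : Matrix n n ℝ} (hM : M.IsSymm)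
    (h : ∀ x, x ⬝ᵥ M *ᵥ x = 0) : M = 0 := by
  apply Matrix.toBilin'.injective
  rw [map_zero]
  apply LinearMap.ext₂
  intro x y
  exact bilin_polarization _ (toBilin'_symm hM) ⊤ (fun z _ => by
    rw [Matrix.toBilin'_apply', h]) x trivial y trivial

lemma isNondissipative_toBilin' {A B : Matrix n n ℝ} (hA : A.IsSymm) (hB : B.IsSymm)
    (hind : LinearIndependent ℝ ![A, B])
    (hnd : ∀ F ∈ Submodule.span ℝ ({A, B} : Set (Matrix n n ℝ)), F.PosSemidef → F = 0) :
    IsNondissipative (Matrix.toBilin' A) (Matrix.toBilin' B) := by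
  intro a b hab
  refine LinearIndependent.pair_iff.mp hind a b
    (hnd _ (Submodule.mem_span_pair.mpr ⟨a, b, rfl⟩) ?_)
  refine Matrix.PosSemidef.of_dotProduct_mulVec_nonneg ?_ fun x => ?_
  · rw [Matrix.IsHermitian, Matrix.conjTranspose_eq_transpose_of_trivial]
    simp [hA.eq, hB.eq]
  · have := hab x
    rw [Matrix.toBilin'_apply', Matrix.toBilin'_apply'] at this
    simpa [Matrix.add_mulVec, Matrix.smul_mulVec, dotProduct_add] using this

end Matrices

section Symplectic

variable {d : ℕ}

lemma symplJ_transpose : (symplJ d)ᵀ = -symplJ d := by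
  simp [symplJ, Matrix.fromBlocks_transpose, Matrix.fromBlocks_neg]

lemma symplJ_transpose_mul : (symplJ d)ᵀ * symplJ d = 1 := by
  simp [symplJ, Matrix.fromBlocks_transpose, Matrix.fromBlocks_multiply]

lemma symplJ_mulVec_dotProduct (x y : Fin d ⊕ Fin d → ℝ) :
    (symplJ d *ᵥ x) ⬝ᵥ (symplJ d *ᵥ y) = x ⬝ᵥ y := by
  rw [Matrix.dotProduct_mulVec, ← Matrix.mulVec_transpose, Matrix.mulVec_mulVec,
    symplJ_transpose_mul, Matrix.one_mulVec]

lemma dotProduct_symplJ_mulVec (x y : Fin d ⊕ Fin d → ℝ) :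
    x ⬝ᵥ (symplJ d *ᵥ y) = -(y ⬝ᵥ (symplJ d *ᵥ x)) := by
  rw [Matrix.dotProduct_mulVec, ← Matrix.mulVec_transpose, symplJ_transpose, dotProduct_comm,
    Matrix.neg_mulVec, dotProduct_neg]

lemma dotProduct_symplJ_mulVec_self (x : Fin d ⊕ Fin d → ℝ) : x ⬝ᵥ (symplJ d *ᵥ x) = 0 := by
  linarith [dotProduct_symplJ_mulVec x x]

lemma isSymm_bracket {A B : Matrix (Fin d ⊕ Fin d) (Fin d ⊕ Fin d) ℝ} (hA : A.IsSymm)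
    (hB : B.IsSymm) : (B * symplJ d * A - A * symplJ d * B).IsSymm := by
  simp only [Matrix.IsSymm, Matrix.transpose_sub, Matrix.transpose_mul, hA.eq, hB.eq,
    symplJ_transpose, Matrix.mul_neg, Matrix.neg_mul, Matrix.mul_assoc]
  abel

lemma dotProduct_bracket_mulVec {A B : Matrix (Fin d ⊕ Fin d) (Fin d ⊕ Fin d) ℝ}
    (hA : A.IsSymm) (hB : B.IsSymm) (x : Fin d ⊕ Fin d → ℝ) :
    x ⬝ᵥ (B * symplJ d * A - A * symplJ d * B) *ᵥ x
      = 2 * Matrix.toBilin' B x (symplJ d *ᵥ (A *ᵥ x)) := by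
  have h1 : ∀ M : Matrix (Fin d ⊕ Fin d) (Fin d ⊕ Fin d) ℝ, M.IsSymm → ∀ y,
      x ⬝ᵥ (M *ᵥ y) = (M *ᵥ x) ⬝ᵥ y := fun M hM y => by
    rw [Matrix.dotProduct_mulVec, ← Matrix.mulVec_transpose, hM.eq]
  rw [Matrix.toBilin'_apply', Matrix.sub_mulVec, dotProduct_sub, ← Matrix.mulVec_mulVec,
    ← Matrix.mulVec_mulVec, ← Matrix.mulVec_mulVec, ← Matrix.mulVec_mulVec, h1 B hB, h1 A hA,
    dotProduct_symplJ_mulVec (A *ᵥ x)]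
  ring

/-- If `F` has rank at most two and the bracket of `F` and `G` vanishes on their common zeros, then
it is a multiple of `F`. -/
lemma exists_bracket_eq_mul_of_rank_le_two {F G : Matrix (Fin d ⊕ Fin d) (Fin d ⊕ Fin d) ℝ}
    (hF : F.IsSymm) (hG : G.IsSymm) (hFr : F.rank ≤ 2) (hGr : 5 ≤ G.rank)
    (hnd : IsNondissipative (Matrix.toBilin' F) (Matrix.toBilin' G))
    (hrad : ∀ x, F *ᵥ x = 0 → G *ᵥ x = 0 →
      (∀ y, F *ᵥ y = 0 → G *ᵥ y = 0 → x ⬝ᵥ symplJ d *ᵥ y = 0) → x = 0)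
    (hZ : ∀ x, x ⬝ᵥ F *ᵥ x = 0 → x ⬝ᵥ G *ᵥ x = 0 →
      x ⬝ᵥ (G * symplJ d * F - F * symplJ d * G) *ᵥ x = 0) :
    ∃ κ : ℝ, ∀ x, x ⬝ᵥ (G * symplJ d * F - F * symplJ d * G) *ᵥ x = κ * (x ⬝ᵥ F *ᵥ x) := by
  obtain ⟨u, hu⟩ := hnd.exists_pos
  obtain ⟨v, hv⟩ := hnd.exists_neg
  obtain ⟨w, w', c, hc, hw, hw', hww', hfac⟩ := exists_factorization_of_finrank_range_le_two
    (Matrix.toBilin' F) (toBilin'_symm hF) (by rwa [finrank_range_toBilin' hF]) hu hv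
  have hdot : ∀ z x, Matrix.toBilin' F z x = (F *ᵥ z) ⬝ᵥ x := fun z x => by
    rw [toBilin'_symm hF, Matrix.toBilin'_apply', dotProduct_comm]
  have hGdot : ∀ z x, Matrix.toBilin' G z x = (G *ᵥ z) ⬝ᵥ x := fun z x => by
    rw [toBilin'_symm hG, Matrix.toBilin'_apply', dotProduct_comm]
  have hFx : ∀ x, c • (F *ᵥ x) = Matrix.toBilin' F w x • (F *ᵥ w')
      + Matrix.toBilin' F w' x • (F *ᵥ w) := by
    intro x
    apply dotProduct_eq
    intro y
    have := hfac x y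
    rw [hdot x y, hdot w y, hdot w' y] at this
    simpa [add_dotProduct, smul_dotProduct] using this
  set X := symplJ d *ᵥ (F *ᵥ w) with hXdef
  set Y := symplJ d *ᵥ (F *ᵥ w') with hYdef
  have hbr : ∀ x, c * (x ⬝ᵥ (G * symplJ d * F - F * symplJ d * G) *ᵥ x) =
      2 * (Matrix.toBilin' F w' x * Matrix.toBilin' G x X
        + Matrix.toBilin' F w x * Matrix.toBilin' G x Y) := by
    intro x
    rw [dotProduct_bracket_mulVec hF hG, mul_left_comm, ← smul_eq_mul (a := c), ← map_smul,
      ← Matrix.mulVec_smul, hFx, Matrix.mulVec_add, Matrix.mulVec_smul, Matrix.mulVec_smul,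
      map_add, map_smul, map_smul, smul_eq_mul, smul_eq_mul, add_comm]
  have hprod : ∀ x, c * (x ⬝ᵥ F *ᵥ x) =
      2 * (Matrix.toBilin' F w x * Matrix.toBilin' F w' x) := by
    intro x
    rw [← Matrix.toBilin'_apply', hfac]
    ring
  have hzero : ∀ x, Matrix.toBilin' F w x * Matrix.toBilin' F w' x = 0 ↔ x ⬝ᵥ F *ᵥ x = 0 := by
    intro x
    have := hprod x
    constructor <;> intro h0 <;> rw [h0] at this
    · exact (mul_eq_zero.mp (by linarith)).resolve_left hc
    · linarith
  have hr : ∀ z z', Matrix.toBilin' F z z' ≠ 0 → Matrix.toBilin' F w (symplJ d *ᵥ (F *ᵥ z)) = 0 →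
      Matrix.toBilin' F w' (symplJ d *ᵥ (F *ᵥ z)) = 0 →
      ∃ x, Matrix.toBilin' G x (symplJ d *ᵥ (F *ᵥ z)) ≠ 0 := by
    intro z z' hz h1 h2
    by_contra! hcon
    have h0 : symplJ d *ᵥ (F *ᵥ z) = 0 := by
      apply hrad
      · have := hFx (symplJ d *ᵥ (F *ᵥ z))
        rw [h1, h2, zero_smul, zero_smul, add_zero] at this
        exact (smul_eq_zero.mp this).resolve_left hc
      · rw [← dotProduct_eq_zero_iff]
        intro y
        rw [← hGdot, toBilin'_symm hG, hcon]
      · intro y hFy _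
        rw [symplJ_mulVec_dotProduct, ← hdot, Matrix.toBilin'_apply', hFy, dotProduct_zero]
    apply hz
    rw [hdot, ← symplJ_mulVec_dotProduct, h0, zero_dotProduct]
  have hlX : Matrix.toBilin' F w X = 0 := by rw [hdot, dotProduct_symplJ_mulVec_self]
  have hmY : Matrix.toBilin' F w' Y = 0 := by rw [hdot, dotProduct_symplJ_mulVec_self]
  have hw'w : Matrix.toBilin' F w' w = c := by rw [toBilin'_symm hF, hww']
  obtain ⟨κ, hκ⟩ := exists_eq_mul_of_zero_on_product (Matrix.toBilin' G) (toBilin'_symm hG)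
    (nonvanishingOnCodim_of_lt_finrank_range _ (toBilin'_symm hG) 2
      (by rw [finrank_range_toBilin' hG]; omega))
    (Matrix.toBilin' F w) (Matrix.toBilin' F w') (X := X) (Y := Y) (e := w) (f := w')
    hw (by rwa [hw'w]) hw' (by rwa [hww']) hlX hmY (hr w w' (by rwa [hww']) hlX)
    (fun h => hr w' w (by rwa [hw'w]) h hmY)
    (by
      obtain ⟨p, hp, hGp⟩ := hnd.exists_isotropic_neg (toBilin'_symm hF) (toBilin'_symm hG)
      exact ⟨p, (hzero p).mpr (by rwa [← Matrix.toBilin'_apply']), hGp⟩)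
    (by
      obtain ⟨p, hp, hGp⟩ := hnd.exists_isotropic_pos (toBilin'_symm hF) (toBilin'_symm hG)
      exact ⟨p, (hzero p).mpr (by rwa [← Matrix.toBilin'_apply']), hGp⟩)
    (fun x hx hGx => by
      have h1 := hbr x
      rw [hZ x ((hzero x).mp hx) (by rwa [← Matrix.toBilin'_apply'])] at h1
      linarith)
  refine ⟨κ, fun x => mul_left_cancel₀ hc ?_⟩
  rw [hbr, hκ, mul_left_comm c κ, hprod]
  ring

/-- If every element of the pencil of `A` and `B` has rank at least three, some element has rank at
least seventeen, and `C` vanishes on the common zeros of `A` and `B`, then `C` lies in the pencil. -/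
lemma exists_eq_combination_of_rank {n : Type*} [Fintype n] [DecidableEq n] {A B C : Matrix n n ℝ}
    (hA : A.IsSymm) (hB : B.IsSymm) (hC : C.IsSymm) (hind : LinearIndependent ℝ ![A, B])
    (hnd : IsNondissipative (Matrix.toBilin' A) (Matrix.toBilin' B))
    (hmin : ∀ F ∈ Submodule.span ℝ ({A, B} : Set (Matrix n n ℝ)), F ≠ 0 → 3 ≤ F.rank)
    (hmax : ∃ F ∈ Submodule.span ℝ ({A, B} : Set (Matrix n n ℝ)), 17 ≤ F.rank)
    (hZ : ∀ x, x ⬝ᵥ A *ᵥ x = 0 → x ⬝ᵥ B *ᵥ x = 0 → x ⬝ᵥ C *ᵥ x = 0) :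
    ∃ r s : ℝ, ∀ x, x ⬝ᵥ C *ᵥ x = r * (x ⬝ᵥ A *ᵥ x) + s * (x ⬝ᵥ B *ᵥ x) := by
  obtain ⟨F, hF, hFr⟩ := hmax
  obtain ⟨a, b, rfl⟩ := Submodule.mem_span_pair.mp hF
  have hsymm : ∀ r s : ℝ, (r • A + s • B).IsSymm := fun r s => (hA.smul r).add (hB.smul s)
  have hab : a * a - b * (-b) ≠ 0 := by
    intro h0
    have ha : a = 0 := by nlinarith [sq_nonneg a, sq_nonneg b]
    have hb : b = 0 := by nlinarith [sq_nonneg a, sq_nonneg b]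
    rw [ha, hb, zero_smul, zero_smul, add_zero, Matrix.rank_zero] at hFr
    omega
  have hnd' := hnd.smul_add_smul a b (-b) a hab
  simp only [← map_smul, ← map_add] at hnd'
  have hq : ∀ (r s : ℝ) x, Matrix.toBilin' (r • A + s • B) x x =
      r * (x ⬝ᵥ A *ᵥ x) + s * (x ⬝ᵥ B *ᵥ x) := fun r s x => by
    rw [Matrix.toBilin'_apply', Matrix.add_mulVec, Matrix.smul_mulVec, Matrix.smul_mulVec,
      dotProduct_add, dotProduct_smul, dotProduct_smul, smul_eq_mul, smul_eq_mul]
  obtain ⟨r, s, hrs⟩ := exists_eq_combination_of_zero_on_common_zeros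
    (Matrix.toBilin' (a • A + b • B)) (Matrix.toBilin' ((-b) • A + a • B)) (Matrix.toBilin' C)
    (toBilin'_symm (hsymm _ _)) (toBilin'_symm (hsymm _ _)) (toBilin'_symm hC) hnd'
    (nonvanishingOnCodim_of_lt_finrank_range _ (toBilin'_symm (hsymm _ _)) 8
      (by rw [finrank_range_toBilin' (hsymm _ _)]; omega))
    (fun p q hpq => by
      have h1 : p • Matrix.toBilin' (a • A + b • B) + q • Matrix.toBilin' ((-b) • A + a • B) =
          Matrix.toBilin' ((p * a - q * b) • A + (p * b + q * a) • B) := by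
        rw [← map_smul, ← map_smul, ← map_add]
        congr 1
        module
      rw [h1]
      refine nonvanishingOnCodim_of_lt_finrank_range _ (toBilin'_symm (hsymm _ _)) 1 ?_
      rw [finrank_range_toBilin' (hsymm _ _)]
      refine hmin _ (Submodule.mem_span_pair.mpr ⟨_, _, rfl⟩) fun h0 => ?_
      obtain ⟨h2, h3⟩ := LinearIndependent.pair_iff.mp hind _ _ h0
      have hp : p = 0 := (mul_eq_zero.mp (show p * (a * a - b * (-b)) = 0 by
        linear_combination a * h2 + b * h3)).resolve_right hab
      have hq : q = 0 := (mul_eq_zero.mp (show q * (a * a - b * (-b)) = 0 by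
        linear_combination a * h3 - b * h2)).resolve_right hab
      simp [hp, hq] at hpq)
    (fun x h1 h2 => by
      rw [hq] at h1 h2
      rw [Matrix.toBilin'_apply']
      apply hZ
      · exact (mul_eq_zero.mp (show (a * a - b * (-b)) * (x ⬝ᵥ A *ᵥ x) = 0 by
          linear_combination a * h1 - b * h2)).resolve_left hab
      · exact (mul_eq_zero.mp (show (a * a - b * (-b)) * (x ⬝ᵥ B *ᵥ x) = 0 by
          linear_combination a * h2 + b * h1)).resolve_left hab)
  refine ⟨r * a - s * b, r * b + s * a, fun x => ?_⟩
  have := hrs x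
  rw [hq, hq, Matrix.toBilin'_apply'] at this
  linear_combination this

/-- If the pencil of `A` and `B` contains elements of rank two and of rank at least nine, the common
kernel of `A` and `B` is symplectic, and the bracket of `A` and `B` vanishes on their common zeros,
then the bracket lies in the pencil. -/
lemma exists_bracket_eq_combination_of_rank_two
    {A B : Matrix (Fin d ⊕ Fin d) (Fin d ⊕ Fin d) ℝ} (hA : A.IsSymm) (hB : B.IsSymm)
    (hnd : IsNondissipative (Matrix.toBilin' A) (Matrix.toBilin' B))
    (hmin : ∃ F ∈ Submodule.span ℝ ({A, B} : Set (Matrix (Fin d ⊕ Fin d) (Fin d ⊕ Fin d) ℝ)),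
      F ≠ 0 ∧ F.rank = 2)
    (hmax : ∃ F ∈ Submodule.span ℝ ({A, B} : Set (Matrix (Fin d ⊕ Fin d) (Fin d ⊕ Fin d) ℝ)),
      9 ≤ F.rank)
    (hrad : ∀ x, A *ᵥ x = 0 → B *ᵥ x = 0 →
      (∀ y, A *ᵥ y = 0 → B *ᵥ y = 0 → x ⬝ᵥ symplJ d *ᵥ y = 0) → x = 0)
    (hZ : ∀ x, x ⬝ᵥ A *ᵥ x = 0 → x ⬝ᵥ B *ᵥ x = 0 →
      x ⬝ᵥ (B * symplJ d * A - A * symplJ d * B) *ᵥ x = 0) :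
    ∃ r s : ℝ, ∀ x, x ⬝ᵥ (B * symplJ d * A - A * symplJ d * B) *ᵥ x =
      r * (x ⬝ᵥ A *ᵥ x) + s * (x ⬝ᵥ B *ᵥ x) := by
  obtain ⟨F, hF, hF0, hFr⟩ := hmin
  obtain ⟨G, hG, hGr⟩ := hmax
  obtain ⟨a, b, hab⟩ := Submodule.mem_span_pair.mp hF
  obtain ⟨p, q, hpq⟩ := Submodule.mem_span_pair.mp hG
  have hFs : F.IsSymm := hab ▸ (hA.smul a).add (hB.smul b)
  have hGs : G.IsSymm := hpq ▸ (hA.smul p).add (hB.smul q)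
  have hrank : ∀ t : ℝ, (t • F).rank ≤ 2 := fun t => by
    rw [← hFr, ← Matrix.mul_one (t • F), Matrix.smul_mul, ← Matrix.mul_smul]
    exact Matrix.rank_mul_le_left _ _
  have hdet : a * q - b * p ≠ 0 := by
    intro h0
    have h1 : a • G = p • F := by
      rw [← hab, ← hpq, smul_add, smul_add, smul_smul, smul_smul, smul_smul, smul_smul,
        mul_comm a p, show a * q = p * b by linarith]
    have h2 : b • G = q • F := by
      rw [← hab, ← hpq, smul_add, smul_add, smul_smul, smul_smul, smul_smul, smul_smul,
        mul_comm b q, show b * p = q * a by linarith]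
    by_cases ha : a = 0
    · by_cases hb : b = 0
      · exact hF0 (by rw [← hab, ha, hb, zero_smul, zero_smul, add_zero])
      · have := hrank (b⁻¹ * q)
        rw [← smul_smul, ← h2, inv_smul_smul₀ hb] at this
        omega
    · have := hrank (a⁻¹ * p)
      rw [← smul_smul, ← h1, inv_smul_smul₀ ha] at this
      omega
  have hbr : G * symplJ d * F - F * symplJ d * G =
      (a * q - b * p) • (B * symplJ d * A - A * symplJ d * B) := by
    rw [← hab, ← hpq]
    simp only [Matrix.add_mul, Matrix.mul_add, Matrix.smul_mul, Matrix.mul_smul]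
    module
  have hFq : ∀ x, x ⬝ᵥ F *ᵥ x = a * (x ⬝ᵥ A *ᵥ x) + b * (x ⬝ᵥ B *ᵥ x) := fun x => by
    rw [← hab, Matrix.add_mulVec, Matrix.smul_mulVec, Matrix.smul_mulVec,
      dotProduct_add, dotProduct_smul, dotProduct_smul, smul_eq_mul, smul_eq_mul]
  have hGq : ∀ x, x ⬝ᵥ G *ᵥ x = p * (x ⬝ᵥ A *ᵥ x) + q * (x ⬝ᵥ B *ᵥ x) := fun x => by
    rw [← hpq, Matrix.add_mulVec, Matrix.smul_mulVec, Matrix.smul_mulVec,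
      dotProduct_add, dotProduct_smul, dotProduct_smul, smul_eq_mul, smul_eq_mul]
  have hker : ∀ x, F *ᵥ x = 0 → G *ᵥ x = 0 → A *ᵥ x = 0 ∧ B *ᵥ x = 0 := by
    intro x h1 h2
    rw [← hab, Matrix.add_mulVec, Matrix.smul_mulVec, Matrix.smul_mulVec] at h1
    rw [← hpq, Matrix.add_mulVec, Matrix.smul_mulVec, Matrix.smul_mulVec] at h2
    constructor
    · refine (smul_eq_zero.mp (show (a * q - b * p) • (A *ᵥ x) = 0 from ?_)).resolve_left hdet
      rw [show (a * q - b * p) • (A *ᵥ x) = q • (a • (A *ᵥ x) + b • (B *ᵥ x))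
        - b • (p • (A *ᵥ x) + q • (B *ᵥ x)) by module, h1, h2, smul_zero, smul_zero, sub_zero]
    · refine (smul_eq_zero.mp (show (a * q - b * p) • (B *ᵥ x) = 0 from ?_)).resolve_left hdet
      rw [show (a * q - b * p) • (B *ᵥ x) = a • (p • (A *ᵥ x) + q • (B *ᵥ x))
        - p • (a • (A *ᵥ x) + b • (B *ᵥ x)) by module, h1, h2, smul_zero, smul_zero, sub_zero]
  have hker' : ∀ x, A *ᵥ x = 0 → B *ᵥ x = 0 → F *ᵥ x = 0 ∧ G *ᵥ x = 0 := by
    intro x h1 h2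
    rw [← hab, ← hpq]
    simp [Matrix.add_mulVec, Matrix.smul_mulVec, h1, h2]
  have hnd' := hnd.smul_add_smul a b p q hdet
  rw [← map_smul, ← map_smul, ← map_smul, ← map_smul, ← map_add, ← map_add, hab, hpq] at hnd'
  obtain ⟨κ, hκ⟩ := exists_bracket_eq_mul_of_rank_le_two hFs hGs hFr.le (by omega) hnd'
    (fun x h1 h2 h3 => hrad x (hker x h1 h2).1 (hker x h1 h2).2 fun y h4 h5 =>
      h3 y (hker' y h4 h5).1 (hker' y h4 h5).2)
    (fun x h1 h2 => by
      rw [hFq] at h1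
      rw [hGq] at h2
      rw [hbr, Matrix.smul_mulVec, dotProduct_smul, hZ x, smul_zero]
      · exact (mul_eq_zero.mp (show (a * q - b * p) * (x ⬝ᵥ A *ᵥ x) = 0 by
          linear_combination q * h1 - b * h2)).resolve_left hdet
      · exact (mul_eq_zero.mp (show (a * q - b * p) * (x ⬝ᵥ B *ᵥ x) = 0 by
          linear_combination a * h2 - p * h1)).resolve_left hdet)
  refine ⟨κ * a / (a * q - b * p), κ * b / (a * q - b * p), fun x => mul_left_cancel₀ hdet ?_⟩
  have h1 := hκ x
  rw [hbr, Matrix.smul_mulVec, dotProduct_smul, smul_eq_mul, hFq] at h1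
  rw [h1]
  field_simp

end Symplectic

end CommonZeros

/-- **Theorem 1.5.** Let `A, B ∈ Sym(2d,ℝ)` be linearly independent, forming a
non-dissipative pair, and let `C := 2(BJA − AJB)` (so that `Q_C = {Q_A, Q_B}` is the Poisson
bracket), with `A, B, C` linearly independent. If either (i) `minrank{A,B} ≥ 3` and
`maxrank{A,B} ≥ 17`, or (ii) `minrank{A,B} = 2`, `maxrank{A,B} ≥ 9`, and the joint radical
`ker A ∩ ker B` is trivial or symplectic, then there is `x` with
`Q_A(x) = Q_B(x) = 0` and `Q_C(x) ≠ 0`. -/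
theorem exists_common_zero_bracket_ne_zero {d : ℕ}
    (A B : Matrix (Fin d ⊕ Fin d) (Fin d ⊕ Fin d) ℝ)
    (hAs : A.IsSymm) (hBs : B.IsSymm)
    (hindAB : LinearIndependent ℝ ![A, B])
    (hnd : ∀ F ∈ Submodule.span ℝ
      ({A, B} : Set (Matrix (Fin d ⊕ Fin d) (Fin d ⊕ Fin d) ℝ)), F.PosSemidef → F = 0)
    (C : Matrix (Fin d ⊕ Fin d) (Fin d ⊕ Fin d) ℝ)
    (hC : C = (2 : ℝ) • (B * symplJ d * A - A * symplJ d * B))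
    (hindABC : LinearIndependent ℝ ![A, B, C])
    (hcase :
      ((∀ F ∈ Submodule.span ℝ
          ({A, B} : Set (Matrix (Fin d ⊕ Fin d) (Fin d ⊕ Fin d) ℝ)), F ≠ 0 → 3 ≤ F.rank) ∧
        (∃ F ∈ Submodule.span ℝ
          ({A, B} : Set (Matrix (Fin d ⊕ Fin d) (Fin d ⊕ Fin d) ℝ)), 17 ≤ F.rank)) ∨
      (((∀ F ∈ Submodule.span ℝ
          ({A, B} : Set (Matrix (Fin d ⊕ Fin d) (Fin d ⊕ Fin d) ℝ)), F ≠ 0 → 2 ≤ F.rank) ∧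
        (∃ F ∈ Submodule.span ℝ
          ({A, B} : Set (Matrix (Fin d ⊕ Fin d) (Fin d ⊕ Fin d) ℝ)), F ≠ 0 ∧ F.rank = 2)) ∧
        (∃ F ∈ Submodule.span ℝ
          ({A, B} : Set (Matrix (Fin d ⊕ Fin d) (Fin d ⊕ Fin d) ℝ)), 9 ≤ F.rank) ∧
        (LinearMap.ker A.mulVecLin ⊓ LinearMap.ker B.mulVecLin = ⊥ ∨
          ∀ v ∈ LinearMap.ker A.mulVecLin ⊓ LinearMap.ker B.mulVecLin,
            (∀ w ∈ LinearMap.ker A.mulVecLin ⊓ LinearMap.ker B.mulVecLin,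
              v ⬝ᵥ (symplJ d).mulVec w = 0) → v = 0))) :
    ∃ x : Fin d ⊕ Fin d → ℝ, x ⬝ᵥ A.mulVec x = 0 ∧ x ⬝ᵥ B.mulVec x = 0 ∧
      x ⬝ᵥ C.mulVec x ≠ 0 := by
  by_contra! hcon
  have hZ : ∀ x, x ⬝ᵥ A *ᵥ x = 0 → x ⬝ᵥ B *ᵥ x = 0 →
      x ⬝ᵥ (B * symplJ d * A - A * symplJ d * B) *ᵥ x = 0 := by
    intro x hA hB
    have h1 := hcon x hA hB
    rw [hC, Matrix.smul_mulVec, dotProduct_smul, smul_eq_mul] at h1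
    linarith
  have hnd' := isNondissipative_toBilin' hAs hBs hindAB hnd
  have hbr := isSymm_bracket hAs hBs
  obtain ⟨r, s, hrs⟩ : ∃ r s : ℝ, ∀ x, x ⬝ᵥ (B * symplJ d * A - A * symplJ d * B) *ᵥ x =
      r * (x ⬝ᵥ A *ᵥ x) + s * (x ⬝ᵥ B *ᵥ x) := by
    rcases hcase with ⟨hmin, hmax⟩ | ⟨⟨-, hmin⟩, hmax, hrad⟩
    · exact exists_eq_combination_of_rank hAs hBs hbr hindAB hnd' hmin hmax hZ
    · refine exists_bracket_eq_combination_of_rank_two hAs hBs hnd' hmin hmax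
        (fun x hAx hBx h => ?_) hZ
      have hx : x ∈ LinearMap.ker A.mulVecLin ⊓ LinearMap.ker B.mulVecLin := ⟨hAx, hBx⟩
      rcases hrad with hrad | hrad
      · rwa [hrad, Submodule.mem_bot] at hx
      · exact hrad x hx fun w hw => h w hw.1 hw.2
  have h0 : B * symplJ d * A - A * symplJ d * B - (r • A + s • B) = 0 := by
    refine eq_zero_of_forall_dotProduct_mulVec
      (hbr.sub ((hAs.smul r).add (hBs.smul s))) fun x => ?_
    rw [Matrix.sub_mulVec, dotProduct_sub, hrs, Matrix.add_mulVec, Matrix.smul_mulVec,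
      Matrix.smul_mulVec, dotProduct_add, dotProduct_smul, dotProduct_smul, smul_eq_mul,
      smul_eq_mul, sub_self]
  have h1 : (-1 : ℝ) = 0 := Fintype.linearIndependent_iff.mp hindABC ![2 * r, 2 * s, -1] (by
    rw [Fin.sum_univ_three]
    simp only [Matrix.cons_val_zero, Matrix.cons_val_one, Matrix.cons_val]
    rw [hC, sub_eq_zero.mp h0]
    module) 2
  norm_num at h1
end

section
/- Let A, B, C ∈ Sym(n,ℝ), where A and B are linearly independent and form a non-dissipative pair with max{rank A, rank B} ≥ 17, and where Q_C(x) = 0 for every x with Q_A(x) = 0 and Q_B(x) = 0. If at least one connected component of 𝒩 spans ℝⁿ, then C is a linear combination of A and B. -/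
open Matrix

namespace QuadricPair

open Filter Topology Module

variable {n : ℕ}

theorem bilin_comm {M : Matrix (Fin n) (Fin n) ℝ} (hM : M.IsSymm) (x y : Fin n → ℝ) :
    x ⬝ᵥ M *ᵥ y = y ⬝ᵥ M *ᵥ x := by
  rw [dotProduct_mulVec, ← mulVec_transpose, hM.eq, dotProduct_comm]

theorem quad_add_smul {M : Matrix (Fin n) (Fin n) ℝ} (hM : M.IsSymm) (x y : Fin n → ℝ) (t : ℝ) :
    (x + t • y) ⬝ᵥ M *ᵥ (x + t • y) =
      x ⬝ᵥ M *ᵥ x + 2 * t * (x ⬝ᵥ M *ᵥ y) + t ^ 2 * (y ⬝ᵥ M *ᵥ y) := by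
  simp only [mulVec_add, mulVec_smul, dotProduct_add, add_dotProduct, smul_dotProduct,
    dotProduct_smul, smul_eq_mul, bilin_comm hM y x]
  ring

/-- The linear functional `v ↦ z ⬝ᵥ M *ᵥ v`. -/
noncomputable def polar (M : Matrix (Fin n) (Fin n) ℝ) (z : Fin n → ℝ) : (Fin n → ℝ) →L[ℝ] ℝ :=
  LinearMap.toContinuousLinearMap (Matrix.toBilin' M z)

theorem polar_apply (M : Matrix (Fin n) (Fin n) ℝ) (z v : Fin n → ℝ) :
    polar M z v = z ⬝ᵥ M *ᵥ v := by
  simp [polar, Matrix.toBilin'_apply']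

theorem continuous_quad (M : Matrix (Fin n) (Fin n) ℝ) :
    Continuous fun x : Fin n → ℝ => x ⬝ᵥ M *ᵥ x := by
  fun_prop

theorem hasStrictFDerivAt_quad {M : Matrix (Fin n) (Fin n) ℝ} (hM : M.IsSymm) (z : Fin n → ℝ) :
    HasStrictFDerivAt (fun x : Fin n → ℝ => x ⬝ᵥ M *ᵥ x) ((2 : ℝ) • polar M z) z := by
  have h : HasStrictFDerivAt (fun x : Fin n → ℝ => ∑ i, x i * (M *ᵥ x) i)
      (∑ i, (z i • ((ContinuousLinearMap.proj (R := ℝ) i).comp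
          (LinearMap.toContinuousLinearMap M.mulVecLin)) +
        (M *ᵥ z) i • ContinuousLinearMap.proj (R := ℝ) (φ := fun _ : Fin n => ℝ) i)) z :=
    HasStrictFDerivAt.fun_sum fun i _ =>
      (ContinuousLinearMap.proj (R := ℝ) (φ := fun _ : Fin n => ℝ) i).hasStrictFDerivAt.mul
        ((ContinuousLinearMap.proj (R := ℝ) i).comp
          (LinearMap.toContinuousLinearMap M.mulVecLin)).hasStrictFDerivAt
  refine h.congr_fderiv ?_
  ext1 v
  have : (2 : ℝ) * (z ⬝ᵥ M *ᵥ v) = z ⬝ᵥ M *ᵥ v + v ⬝ᵥ M *ᵥ z := by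
    rw [bilin_comm hM v z]; ring
  rw [_root_.smul_apply, polar_apply, smul_eq_mul, this]
  simp [Finset.sum_add_distrib, dotProduct, mul_comm]

theorem exists_curve {A B : Matrix (Fin n) (Fin n) ℝ} (hAs : A.IsSymm) (hBs : B.IsSymm)
    {z : Fin n → ℝ} (hA : z ⬝ᵥ A *ᵥ z = 0) (hB : z ⬝ᵥ B *ᵥ z = 0)
    (hind : LinearIndependent ℝ ![A *ᵥ z, B *ᵥ z]) {v : Fin n → ℝ}
    (hvA : z ⬝ᵥ A *ᵥ v = 0) (hvB : z ⬝ᵥ B *ᵥ v = 0) :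
    ∃ φ : ℝ → Fin n → ℝ, HasDerivAt φ v 0 ∧ φ 0 = z ∧
      ∀ᶠ t in 𝓝 0, φ t ⬝ᵥ A *ᵥ φ t = 0 ∧ φ t ⬝ᵥ B *ᵥ φ t = 0 := by
  have hf := (hasStrictFDerivAt_quad hAs z).prodMk (hasStrictFDerivAt_quad hBs z)
  have hsurj : (((2 : ℝ) • polar A z).prod ((2 : ℝ) • polar B z)).range = ⊤ := by
    by_contra hne
    obtain ⟨Λ, hΛ, hle⟩ := Submodule.exists_le_ker_of_lt_top _ (lt_top_iff_ne_top.2 hne)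
    have hrel : Λ (1, 0) • (A *ᵥ z) + Λ (0, 1) • (B *ᵥ z) = 0 := by
      apply dotProduct_eq_zero
      intro v
      have hv : Λ (2 * (z ⬝ᵥ A *ᵥ v), 2 * (z ⬝ᵥ B *ᵥ v)) = 0 :=
        hle ⟨v, by simp [polar_apply]⟩
      have hdec : ((2 * (z ⬝ᵥ A *ᵥ v), 2 * (z ⬝ᵥ B *ᵥ v)) : ℝ × ℝ) =
          (2 * (z ⬝ᵥ A *ᵥ v)) • ((1 : ℝ), (0 : ℝ)) + (2 * (z ⬝ᵥ B *ᵥ v)) • ((0 : ℝ), (1 : ℝ)) := by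
        simp
      rw [hdec, map_add, map_smul, map_smul, bilin_comm hAs, bilin_comm hBs] at hv
      simp only [smul_eq_mul] at hv
      rw [add_dotProduct, smul_dotProduct, smul_dotProduct, dotProduct_comm _ v,
        dotProduct_comm _ v, smul_eq_mul, smul_eq_mul]
      linarith
    obtain ⟨h1, h2⟩ := LinearIndependent.pair_iff.1 hind _ _ hrel
    exact hΛ (LinearMap.ext fun p => by
      have : p = p.1 • ((1 : ℝ), (0 : ℝ)) + p.2 • ((0 : ℝ), (1 : ℝ)) := by simp
      rw [this, map_add, map_smul, map_smul, h1, h2]; simp)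
  set g := hf.implicitFunction _ _ hsurj
  have hv : v ∈ (((2 : ℝ) • polar A z).prod ((2 : ℝ) • polar B z)).ker := by
    simp [LinearMap.mem_ker, polar_apply, hvA, hvB]
  have hline : HasDerivAt (fun t : ℝ => t • (⟨v, hv⟩ :
      (((2 : ℝ) • polar A z).prod ((2 : ℝ) • polar B z)).ker)) ⟨v, hv⟩ 0 := by
    have h := (hasDerivAt_id (0 : ℝ)).smul_const (⟨v, hv⟩ :
      (((2 : ℝ) • polar A z).prod ((2 : ℝ) • polar B z)).ker)
    rwa [one_smul] at h
  have hto := hf.to_implicitFunction hsurj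
  refine ⟨fun t => g (z ⬝ᵥ A *ᵥ z, z ⬝ᵥ B *ᵥ z) (t • ⟨v, hv⟩), ?_, ?_, ?_⟩
  · have hto' := hto.hasFDerivAt
    rw [← zero_smul ℝ (⟨v, hv⟩ : (((2 : ℝ) • polar A z).prod ((2 : ℝ) • polar B z)).ker)] at hto'
    exact hto'.comp_hasDerivAt 0 hline
  · simp only [zero_smul]
    exact hf.implicitFunction_apply_image hsurj
  · have hev := hf.map_implicitFunction_eq hsurj
    have htend : Tendsto (fun t : ℝ => (((z ⬝ᵥ A *ᵥ z, z ⬝ᵥ B *ᵥ z), t • ⟨v, hv⟩) :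
        (ℝ × ℝ) × (((2 : ℝ) • polar A z).prod ((2 : ℝ) • polar B z)).ker)) (𝓝 0)
        (𝓝 ((z ⬝ᵥ A *ᵥ z, z ⬝ᵥ B *ᵥ z), 0)) := by
      refine tendsto_const_nhds.prodMk_nhds ?_
      have h := hline.continuousAt.tendsto
      rwa [zero_smul] at h
    filter_upwards [htend.eventually hev] with t ht
    rw [Prod.ext_iff] at ht
    exact ⟨ht.1.trans hA, ht.2.trans hB⟩

theorem exists_multipliers {A B C : Matrix (Fin n) (Fin n) ℝ} (hAs : A.IsSymm)
    (hBs : B.IsSymm) (hCs : C.IsSymm)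
    (hvanish : ∀ x : Fin n → ℝ, x ⬝ᵥ A *ᵥ x = 0 → x ⬝ᵥ B *ᵥ x = 0 → x ⬝ᵥ C *ᵥ x = 0)
    {z : Fin n → ℝ} (hA : z ⬝ᵥ A *ᵥ z = 0) (hB : z ⬝ᵥ B *ᵥ z = 0)
    (hind : LinearIndependent ℝ ![A *ᵥ z, B *ᵥ z]) :
    ∃ α β : ℝ, C *ᵥ z = α • A *ᵥ z + β • B *ᵥ z := by
  have hT : ∀ v, z ⬝ᵥ A *ᵥ v = 0 → z ⬝ᵥ B *ᵥ v = 0 → z ⬝ᵥ C *ᵥ v = 0 := by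
    intro v hvA hvB
    obtain ⟨φ, hφ, hφ0, hev⟩ := exists_curve hAs hBs hA hB hind hvA hvB
    subst hφ0
    have h1 := (hasStrictFDerivAt_quad hCs (φ 0)).hasFDerivAt.comp_hasDerivAt 0 hφ
    have h2 : ((fun x => x ⬝ᵥ C *ᵥ x) ∘ φ) =ᶠ[𝓝 0] fun _ => 0 :=
      hev.mono fun t ht => hvanish _ ht.1 ht.2
    have h3 := h1.unique ((hasDerivAt_const (0 : ℝ) (0 : ℝ)).congr_of_eventuallyEq h2)
    simpa [polar_apply] using h3
  have hmem : (polar C z).toLinearMap ∈ Submodule.span ℝ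
      (Set.range ![(polar A z).toLinearMap, (polar B z).toLinearMap]) := by
    apply mem_span_of_iInf_ker_le_ker
    intro v hv
    simp only [Submodule.mem_iInf, Fin.forall_fin_two, LinearMap.mem_ker] at hv
    simpa [polar_apply] using hT v (by simpa [polar_apply] using hv.1)
      (by simpa [polar_apply] using hv.2)
  simp only [Matrix.range_cons, Matrix.range_empty, Set.union_empty, Set.singleton_union] at hmem
  obtain ⟨α, β, h⟩ := Submodule.mem_span_pair.1 hmem
  refine ⟨α, β, dotProduct_eq _ _ fun v => ?_⟩
  have hv := LinearMap.congr_fun h v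
  simp only [LinearMap.add_apply, LinearMap.smul_apply, ContinuousLinearMap.coe_coe, polar_apply,
    smul_eq_mul] at hv
  rw [add_dotProduct, smul_dotProduct, smul_dotProduct, dotProduct_comm _ v, dotProduct_comm _ v,
    dotProduct_comm _ v, bilin_comm hAs v, bilin_comm hBs v, bilin_comm hCs v, smul_eq_mul,
    smul_eq_mul, hv]

theorem quad_eq_zero_of_tangent {A B C : Matrix (Fin n) (Fin n) ℝ} (hAs : A.IsSymm)
    (hBs : B.IsSymm) (hCs : C.IsSymm)
    (hvanish : ∀ x : Fin n → ℝ, x ⬝ᵥ A *ᵥ x = 0 → x ⬝ᵥ B *ᵥ x = 0 → x ⬝ᵥ C *ᵥ x = 0)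
    {z : Fin n → ℝ} (hA : z ⬝ᵥ A *ᵥ z = 0) (hB : z ⬝ᵥ B *ᵥ z = 0)
    (hind : LinearIndependent ℝ ![A *ᵥ z, B *ᵥ z])
    (hz : C *ᵥ z = 0) {v : Fin n → ℝ}
    (hvA : z ⬝ᵥ A *ᵥ v = 0) (hvB : z ⬝ᵥ B *ᵥ v = 0) : v ⬝ᵥ C *ᵥ v = 0 := by
  obtain ⟨φ, hφ, hφ0, hev⟩ := exists_curve hAs hBs hA hB hind hvA hvB
  have hslope := hφ.tendsto_slope_zero
  have hlim := ((continuous_quad C).tendsto v).comp hslope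
  refine tendsto_nhds_unique (hlim.congr' (f₂ := fun _ => 0) ?_) tendsto_const_nhds
  filter_upwards [hev.filter_mono nhdsWithin_le_nhds] with t ht
  have h := hvanish _ ht.1 ht.2
  have hzC : ∀ w, z ⬝ᵥ C *ᵥ w = 0 := fun w => by rw [bilin_comm hCs, hz, dotProduct_zero]
  simp only [Function.comp_apply, zero_add, hφ0, mulVec_smul, mulVec_sub, smul_dotProduct,
    dotProduct_smul, sub_dotProduct, dotProduct_sub, h, hz, hzC, dotProduct_zero]
  simp

theorem rank_add_two_mul_finrank_le {M : Matrix (Fin n) (Fin n) ℝ} (hM : M.IsSymm)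
    (W : Submodule ℝ (Fin n → ℝ)) (hW : ∀ v ∈ W, v ⬝ᵥ M *ᵥ v = 0) :
    M.rank + 2 * finrank ℝ W ≤ 2 * n := by
  have hle : W ≤ (Matrix.toBilin' M).orthogonal W := by
    intro y hy x hx
    have h := quad_add_smul hM x y 1
    rw [hW _ (W.add_mem hx (W.smul_mem _ hy)), hW x hx, hW y hy] at h
    change Matrix.toBilin' M x y = 0
    rw [Matrix.toBilin'_apply']
    linarith
  have h1 := LinearMap.BilinForm.finrank_add_finrank_orthogonal' (B := Matrix.toBilin' M) W
  have h2 : finrank ℝ (W ⊓ (Matrix.toBilin' M).ker : Submodule ℝ (Fin n → ℝ)) ≤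
      finrank ℝ (LinearMap.ker M.mulVecLin) := by
    apply Submodule.finrank_mono
    rintro x ⟨-, hx⟩
    rw [LinearMap.mem_ker, mulVecLin_apply]
    apply dotProduct_eq_zero
    intro v
    have := LinearMap.congr_fun (LinearMap.mem_ker.1 hx) v
    rw [Matrix.toBilin'_apply', bilin_comm hM] at this
    rw [dotProduct_comm]
    exact this
  have h3 := Submodule.finrank_mono hle
  have h4 := M.mulVecLin.finrank_range_add_finrank_ker
  have h5 : M.rank = finrank ℝ (LinearMap.range M.mulVecLin) := rfl
  simp only [finrank_fin_fun] at h1 h4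
  omega

theorem rank_le_four_of_mulVec_eq_zero {A B C : Matrix (Fin n) (Fin n) ℝ} (hAs : A.IsSymm)
    (hBs : B.IsSymm) (hCs : C.IsSymm)
    (hvanish : ∀ x : Fin n → ℝ, x ⬝ᵥ A *ᵥ x = 0 → x ⬝ᵥ B *ᵥ x = 0 → x ⬝ᵥ C *ᵥ x = 0)
    {z : Fin n → ℝ} (hA : z ⬝ᵥ A *ᵥ z = 0) (hB : z ⬝ᵥ B *ᵥ z = 0)
    (hind : LinearIndependent ℝ ![A *ᵥ z, B *ᵥ z]) (hz : C *ᵥ z = 0) : C.rank ≤ 4 := by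
  have h1 := rank_add_two_mul_finrank_le hCs
    (LinearMap.ker ((polar A z).toLinearMap.prod (polar B z).toLinearMap)) fun v hv => by
      rw [LinearMap.ker_prod, Submodule.mem_inf, LinearMap.mem_ker, LinearMap.mem_ker,
        ContinuousLinearMap.coe_coe, ContinuousLinearMap.coe_coe, polar_apply, polar_apply] at hv
      exact quad_eq_zero_of_tangent hAs hBs hCs hvanish hA hB hind hz hv.1 hv.2
  have h2 := LinearMap.finrank_range_add_finrank_ker
    ((polar A z).toLinearMap.prod (polar B z).toLinearMap)
  have h3 := Submodule.finrank_le
    (LinearMap.range ((polar A z).toLinearMap.prod (polar B z).toLinearMap))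
  simp only [finrank_fin_fun, finrank_prod, finrank_self] at h2 h3
  omega

theorem eq_zero_of_quad_eq_zero {M : Matrix (Fin n) (Fin n) ℝ} (hM : M.IsSymm)
    (h : ∀ v, v ⬝ᵥ M *ᵥ v = 0) : M = 0 := by
  have hr := rank_add_two_mul_finrank_le hM ⊤ fun v _ => h v
  rw [finrank_top, finrank_fin_fun] at hr
  have h0 : finrank ℝ (LinearMap.range M.mulVecLin) = 0 := by
    change M.rank = 0
    omega
  rw [Submodule.finrank_eq_zero, LinearMap.range_eq_bot] at h0
  exact Matrix.toLin'.injective (h0.trans (map_zero _).symm)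

theorem eq_zero_of_quad_eventually_eq_zero {M : Matrix (Fin n) (Fin n) ℝ} (hM : M.IsSymm)
    {u : Fin n → ℝ} (h : ∀ᶠ x in 𝓝 u, x ⬝ᵥ M *ᵥ x = 0) : M = 0 := by
  refine eq_zero_of_quad_eq_zero hM fun v => ?_
  have hlim (c : ℝ) : Tendsto (fun t : ℝ => u + (c * t) • v) (𝓝[≠] 0) (𝓝 u) := by
    have : Continuous fun t : ℝ => u + (c * t) • v := by fun_prop
    simpa using (this.tendsto 0).mono_left nhdsWithin_le_nhds
  obtain ⟨t, ⟨h1, h2⟩, ht⟩ := (((hlim 1).eventually h).and ((hlim (-1)).eventually h)).and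
    self_mem_nhdsWithin |>.exists
  rw [quad_add_smul hM, h.self_of_nhds] at h1 h2
  have : t ^ 2 * (v ⬝ᵥ M *ᵥ v) = 0 := by linarith
  exact (mul_eq_zero.1 this).resolve_left (pow_ne_zero 2 ht)

theorem exists_mem_ker_quad_ne_zero {A C D : Matrix (Fin n) (Fin n) ℝ} (hAs : A.IsSymm)
    (hrank : 2 * (C.rank + D.rank) < A.rank) :
    ∃ k, C *ᵥ k = 0 ∧ D *ᵥ k = 0 ∧ k ⬝ᵥ A *ᵥ k ≠ 0 := by
  by_contra! h
  have h1 := rank_add_two_mul_finrank_le hAs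
    (LinearMap.ker C.mulVecLin ⊓ LinearMap.ker D.mulVecLin) fun v hv => h v hv.1 hv.2
  have h2 := Submodule.finrank_sup_add_finrank_inf_eq
    (LinearMap.ker C.mulVecLin) (LinearMap.ker D.mulVecLin)
  have h3 := Submodule.finrank_le (LinearMap.ker C.mulVecLin ⊔ LinearMap.ker D.mulVecLin)
  have h4 := C.mulVecLin.finrank_range_add_finrank_ker
  have h5 := D.mulVecLin.finrank_range_add_finrank_ker
  have h6 : C.rank = finrank ℝ (LinearMap.range C.mulVecLin) := rfl
  have h7 : D.rank = finrank ℝ (LinearMap.range D.mulVecLin) := rfl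
  simp only [finrank_fin_fun] at h3 h4 h5
  omega

theorem exists_dotProduct_eq_zero_ne_zero {f g : Fin n → ℝ}
    (h : LinearIndependent ℝ ![f, g]) : ∃ v, f ⬝ᵥ v = 0 ∧ g ⬝ᵥ v ≠ 0 := by
  have hf : f ≠ 0 := h.ne_zero 0
  have hv : f ⬝ᵥ ((f ⬝ᵥ f) • g - (f ⬝ᵥ g) • f) = 0 := by
    simp only [dotProduct_sub, dotProduct_smul, smul_eq_mul]
    ring
  refine ⟨(f ⬝ᵥ f) • g - (f ⬝ᵥ g) • f, hv, fun hg => ?_⟩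
  have h0 : (f ⬝ᵥ f) • g - (f ⬝ᵥ g) • f = 0 := by
    rw [← dotProduct_self_eq_zero]
    conv_lhs => rw [sub_dotProduct, smul_dotProduct, smul_dotProduct, hv, hg]
    simp
  have h1 := LinearIndependent.pair_iff.1 h (-(f ⬝ᵥ g)) (f ⬝ᵥ f) (by rw [← h0]; module)
  exact hf (dotProduct_self_eq_zero.1 h1.2)

theorem quad_eq_zero_of_mul_neg {F A C : Matrix (Fin n) (Fin n) ℝ} (hFs : F.IsSymm)
    (hAs : A.IsSymm) (hCs : C.IsSymm)
    (hvanish : ∀ x : Fin n → ℝ, x ⬝ᵥ F *ᵥ x = 0 → x ⬝ᵥ A *ᵥ x = 0 → x ⬝ᵥ C *ᵥ x = 0)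
    {k : Fin n → ℝ} (hFk : F *ᵥ k = 0) (hCk : C *ᵥ k = 0) {y : Fin n → ℝ}
    (hFy : y ⬝ᵥ F *ᵥ y = 0) (hAy : (y ⬝ᵥ A *ᵥ y) * (k ⬝ᵥ A *ᵥ k) < 0) :
    y ⬝ᵥ C *ᵥ y = 0 := by
  have hq : k ⬝ᵥ A *ᵥ k ≠ 0 := right_ne_zero_of_mul hAy.ne
  have hsq := Real.sq_sqrt (show 0 ≤ (y ⬝ᵥ A *ᵥ k) ^ 2 - (y ⬝ᵥ A *ᵥ y) * (k ⬝ᵥ A *ᵥ k) by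
    nlinarith [sq_nonneg (y ⬝ᵥ A *ᵥ k)])
  set r := √((y ⬝ᵥ A *ᵥ k) ^ 2 - (y ⬝ᵥ A *ᵥ y) * (k ⬝ᵥ A *ᵥ k))
  have h := hvanish (y + ((-(y ⬝ᵥ A *ᵥ k) + r) / (k ⬝ᵥ A *ᵥ k)) • k)
    (by rw [quad_add_smul hFs, hFk, hFy]; simp)
    (by rw [quad_add_smul hAs]; field_simp; linear_combination hsq)
  rw [quad_add_smul hCs, hCk] at h
  simpa using h

theorem eq_zero_of_vanish_of_mulVec_eq_zero {F A C : Matrix (Fin n) (Fin n) ℝ} (hFs : F.IsSymm)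
    (hAs : A.IsSymm) (hCs : C.IsSymm)
    (hvanish : ∀ x : Fin n → ℝ, x ⬝ᵥ F *ᵥ x = 0 → x ⬝ᵥ A *ᵥ x = 0 → x ⬝ᵥ C *ᵥ x = 0)
    {k : Fin n → ℝ} (hFk : F *ᵥ k = 0) (hCk : C *ᵥ k = 0) (hAk : k ⬝ᵥ A *ᵥ k ≠ 0)
    {z : Fin n → ℝ} (hFz : z ⬝ᵥ F *ᵥ z = 0) (hAz : z ⬝ᵥ A *ᵥ z = 0) (hCz : C *ᵥ z = 0)
    {u w : Fin n → ℝ} (hw : z ⬝ᵥ F *ᵥ w ≠ 0) (hFu : z ⬝ᵥ F *ᵥ u = 0) (hAu : z ⬝ᵥ A *ᵥ u ≠ 0)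
    (hu : u ⬝ᵥ F *ᵥ u ≠ 0) : C = 0 := by
  set g : (Fin n → ℝ) → ℝ := fun x => ((z ⬝ᵥ F *ᵥ x) * (x ⬝ᵥ A *ᵥ x) -
    (x ⬝ᵥ F *ᵥ x) * (z ⬝ᵥ A *ᵥ x)) * (k ⬝ᵥ A *ᵥ k) with hg
  have hgc : Continuous g := by fun_prop
  have hgu : g u ≠ 0 := by simp [hg, hFu, hAu, hu, hAk]
  have hquad : ∀ (M : Matrix (Fin n) (Fin n) ℝ), M.IsSymm → ∀ (x : Fin n → ℝ) (a t : ℝ),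
      (a • z + t • x) ⬝ᵥ M *ᵥ (a • z + t • x) = a ^ 2 * (z ⬝ᵥ M *ᵥ z) +
        2 * a * t * (z ⬝ᵥ M *ᵥ x) + t ^ 2 * (x ⬝ᵥ M *ᵥ x) := by
    intro M hM x a t
    rw [quad_add_smul hM]
    simp only [smul_dotProduct, mulVec_smul, dotProduct_smul, smul_eq_mul]
    ring
  have hzero : ∀ x, (z ⬝ᵥ F *ᵥ x) * g x < 0 → x ⬝ᵥ C *ᵥ x = 0 := by
    intro x hx
    have hb : z ⬝ᵥ F *ᵥ x ≠ 0 := left_ne_zero_of_mul hx.ne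
    have h := quad_eq_zero_of_mul_neg hFs hAs hCs hvanish hFk hCk
      (y := (x ⬝ᵥ F *ᵥ x) • z + (-2 * (z ⬝ᵥ F *ᵥ x)) • x)
      (by rw [hquad F hFs, hFz]; ring)
      (by
        rw [hquad A hAs, hAz]
        have : ((x ⬝ᵥ F *ᵥ x) ^ 2 * 0 +
            2 * (x ⬝ᵥ F *ᵥ x) * (-2 * (z ⬝ᵥ F *ᵥ x)) * (z ⬝ᵥ A *ᵥ x) +
            (-2 * (z ⬝ᵥ F *ᵥ x)) ^ 2 * (x ⬝ᵥ A *ᵥ x)) * (k ⬝ᵥ A *ᵥ k) =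
            4 * ((z ⬝ᵥ F *ᵥ x) * g x) := by
          simp only [hg]; ring
        rw [this]
        linarith)
    rw [hquad C hCs, bilin_comm hCs z x, hCz] at h
    simpa [hb] using h
  obtain ⟨τ, hτ, hτ0⟩ : ∃ τ : ℝ, 0 < g (u + (-τ * (z ⬝ᵥ F *ᵥ w) * g u) • w) * g u ∧ 0 < τ := by
    have hc : Continuous fun τ : ℝ => g (u + (-τ * (z ⬝ᵥ F *ᵥ w) * g u) • w) * g u := by fun_prop
    have hpos : 0 < g (u + (-(0 : ℝ) * (z ⬝ᵥ F *ᵥ w) * g u) • w) * g u := by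
      simpa using mul_self_pos.2 hgu
    exact ((((hc.tendsto 0).eventually (lt_mem_nhds hpos)).filter_mono nhdsWithin_le_nhds).and
      (self_mem_nhdsWithin (s := Set.Ioi (0 : ℝ)))).exists
  refine eq_zero_of_quad_eventually_eq_zero hCs
    (u := u + (-τ * (z ⬝ᵥ F *ᵥ w) * g u) • w) ?_
  have hc : Continuous fun x => (z ⬝ᵥ F *ᵥ x) * g x := by fun_prop
  have hneg : (z ⬝ᵥ F *ᵥ (u + (-τ * (z ⬝ᵥ F *ᵥ w) * g u) • w)) *
      g (u + (-τ * (z ⬝ᵥ F *ᵥ w) * g u) • w) < 0 := by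
    have : z ⬝ᵥ F *ᵥ (u + (-τ * (z ⬝ᵥ F *ᵥ w) * g u) • w) =
        -τ * (z ⬝ᵥ F *ᵥ w) ^ 2 * g u := by
      rw [mulVec_add, mulVec_smul, dotProduct_add, dotProduct_smul, hFu, smul_eq_mul]; ring
    rw [this]
    have := mul_pos (mul_pos hτ0 (sq_pos_of_ne_zero hw)) hτ
    linarith
  exact ((hc.tendsto _).eventually (gt_mem_nhds hneg)).mono fun x hx => hzero x hx

theorem quad_eq_zero_of_forall_or {F A : Matrix (Fin n) (Fin n) ℝ} (hFs : F.IsSymm)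
    {z v : Fin n → ℝ} (hv : z ⬝ᵥ F *ᵥ v = 0) (hAv : z ⬝ᵥ A *ᵥ v ≠ 0)
    (h : ∀ u, z ⬝ᵥ F *ᵥ u = 0 → z ⬝ᵥ A *ᵥ u ≠ 0 → u ⬝ᵥ F *ᵥ u = 0) {u : Fin n → ℝ}
    (hu : z ⬝ᵥ F *ᵥ u = 0) : u ⬝ᵥ F *ᵥ u = 0 := by
  by_cases hAu : z ⬝ᵥ A *ᵥ u = 0
  · have hsum (t : ℝ) (ht : t ≠ 0) : (u + t • v) ⬝ᵥ F *ᵥ (u + t • v) = 0 :=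
      h _ (by simp [mulVec_add, mulVec_smul, hu, hv])
        (by simp [mulVec_add, mulVec_smul, hAu, hAv, ht])
    have h1 := hsum 1 one_ne_zero
    have h2 := hsum (-1) (by norm_num)
    rw [quad_add_smul hFs, h v hv hAv] at h1 h2
    linarith
  · exact h u hu hAu

theorem polar_eq_zero_of_isPreconnected {F : Matrix (Fin n) (Fin n) ℝ} (hFs : F.IsSymm)
    {S : Set (Fin n → ℝ)} (hS : IsPreconnected S) (hSF : ∀ y ∈ S, y ⬝ᵥ F *ᵥ y = 0)
    (hS0 : ∀ y ∈ S, F *ᵥ y ≠ 0) {z : Fin n → ℝ} (hz : z ∈ S)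
    (h : ∀ u, z ⬝ᵥ F *ᵥ u = 0 → u ⬝ᵥ F *ᵥ u = 0) {y : Fin n → ℝ} (hy : y ∈ S) :
    z ⬝ᵥ F *ᵥ y = 0 := by
  have hpos : z ⬝ᵥ F *ᵥ (F *ᵥ z) ≠ 0 := by
    rw [bilin_comm hFs, Ne, dotProduct_self_eq_zero]
    exact hS0 z hz
  set w : Fin n → ℝ := (z ⬝ᵥ F *ᵥ (F *ᵥ z))⁻¹ • F *ᵥ z
  have hw : z ⬝ᵥ F *ᵥ w = 1 := by
    rw [mulVec_smul, dotProduct_smul, smul_eq_mul, inv_mul_cancel₀ hpos]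
  set q : (Fin n → ℝ) → ℝ := fun y => 2 * (w ⬝ᵥ F *ᵥ y) - (w ⬝ᵥ F *ᵥ w) * (z ⬝ᵥ F *ᵥ y) with hq
  have hqc : Continuous q := by fun_prop
  have hqadd (x y) : q (x + y) = q x + q y := by
    simp only [hq, mulVec_add, dotProduct_add]; ring
  have hfac (y) : y ⬝ᵥ F *ᵥ y = (z ⬝ᵥ F *ᵥ y) * q y := by
    have h1 := h (y + (-(z ⬝ᵥ F *ᵥ y)) • w)
      (by rw [mulVec_add, mulVec_smul, dotProduct_add, dotProduct_smul, hw, smul_eq_mul]; ring)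
    rw [quad_add_smul hFs, bilin_comm hFs y w] at h1
    simp only [hq]
    linear_combination h1
  have hne (y) (hy : y ∈ S) (hzy : z ⬝ᵥ F *ᵥ y = 0) : q y ≠ 0 := by
    intro hqy
    refine hS0 y hy (dotProduct_eq_zero _ fun v => ?_)
    have h1 := quad_add_smul hFs y v 1
    rw [hSF y hy, one_smul, hfac (y + v), hfac v, hqadd, mulVec_add, dotProduct_add, hzy, hqy] at h1
    rw [dotProduct_comm, bilin_comm hFs]
    linarith
  by_contra hcon
  obtain ⟨x, hxS, hx1, hx2⟩ := hS {x | z ⬝ᵥ F *ᵥ x ≠ 0} {x | q x ≠ 0}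
    (isOpen_ne_fun (by fun_prop) continuous_const) (isOpen_ne_fun hqc continuous_const)
    (fun x hx => or_iff_not_imp_left.2 fun hx' => hne x hx (not_not.1 hx'))
    ⟨y, hy, hcon⟩ ⟨z, hz, hne z hz (hSF z hz)⟩
  exact mul_ne_zero hx1 hx2 ((hfac x).symm.trans (hSF x hxS))

theorem eq_zero_of_isPreconnected_of_span_eq_top {F A C : Matrix (Fin n) (Fin n) ℝ} (hFs : F.IsSymm)
    (hAs : A.IsSymm) (hCs : C.IsSymm)
    (hvanish : ∀ x : Fin n → ℝ, x ⬝ᵥ F *ᵥ x = 0 → x ⬝ᵥ A *ᵥ x = 0 → x ⬝ᵥ C *ᵥ x = 0)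
    {k : Fin n → ℝ} (hFk : F *ᵥ k = 0) (hCk : C *ᵥ k = 0) (hAk : k ⬝ᵥ A *ᵥ k ≠ 0)
    {S : Set (Fin n → ℝ)} (hS : IsPreconnected S) (hSF : ∀ y ∈ S, y ⬝ᵥ F *ᵥ y = 0)
    (hSA : ∀ y ∈ S, y ⬝ᵥ A *ᵥ y = 0)
    (hind : ∀ y ∈ S, LinearIndependent ℝ ![F *ᵥ y, A *ᵥ y])
    (hspan : Submodule.span ℝ S = ⊤) {z : Fin n → ℝ} (hz : z ∈ S) (hCz : C *ᵥ z = 0) :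
    C = 0 := by
  have hS0 : ∀ y ∈ S, F *ᵥ y ≠ 0 := fun y hy => (hind y hy).ne_zero 0
  have hw : z ⬝ᵥ F *ᵥ (F *ᵥ z) ≠ 0 := by
    rw [bilin_comm hFs, Ne, dotProduct_self_eq_zero]
    exact hS0 z hz
  obtain ⟨v, hFv, hAv⟩ := exists_dotProduct_eq_zero_ne_zero (hind z hz)
  rw [dotProduct_comm, bilin_comm hFs] at hFv
  rw [dotProduct_comm, bilin_comm hAs] at hAv
  by_contra hC
  have hor : ∀ u, z ⬝ᵥ F *ᵥ u = 0 → z ⬝ᵥ A *ᵥ u ≠ 0 → u ⬝ᵥ F *ᵥ u = 0 := by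
    intro u hFu hAu
    by_contra hu
    exact hC (eq_zero_of_vanish_of_mulVec_eq_zero hFs hAs hCs hvanish hFk hCk hAk
      (hSF z hz) (hSA z hz) hCz hw hFu hAu hu)
  have hker : Submodule.span ℝ S ≤ LinearMap.ker (polar F z).toLinearMap :=
    Submodule.span_le.2 fun y hy => (polar_apply F z y).trans
      (polar_eq_zero_of_isPreconnected hFs hS hSF hS0 hz
        (fun u hu => quad_eq_zero_of_forall_or hFs hFv hAv hor hu) hy)
  rw [hspan] at hker
  exact hw ((polar_apply F z _).symm.trans (hker (Submodule.mem_top (x := F *ᵥ z))))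

theorem exists_smul_add_smul_of_rank {A B C : Matrix (Fin n) (Fin n) ℝ}
    (hAs : A.IsSymm) (hBs : B.IsSymm) (hCs : C.IsSymm) (hrank : 17 ≤ A.rank)
    (hvanish : ∀ x : Fin n → ℝ, x ⬝ᵥ A *ᵥ x = 0 → x ⬝ᵥ B *ᵥ x = 0 → x ⬝ᵥ C *ᵥ x = 0)
    {S : Set (Fin n → ℝ)} (hS : IsPreconnected S)
    (hSN : ∀ y ∈ S, y ⬝ᵥ A *ᵥ y = 0 ∧ y ⬝ᵥ B *ᵥ y = 0 ∧
      LinearIndependent ℝ ![A *ᵥ y, B *ᵥ y])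
    (hspan : Submodule.span ℝ S = ⊤) {z : Fin n → ℝ} (hz : z ∈ S) :
    ∃ α β : ℝ, C = α • A + β • B := by
  obtain ⟨hzA, hzB, hzI⟩ := hSN z hz
  obtain ⟨α₀, β₀, h₀⟩ := exists_multipliers hAs hBs hCs hvanish hzA hzB hzI
  set C₀ := C - (α₀ • A + β₀ • B) with hC₀
  suffices C₀ = 0 from ⟨α₀, β₀, sub_eq_zero.1 this⟩
  have hC₀s : C₀.IsSymm := hCs.sub ((hAs.smul _).add (hBs.smul _))
  have hC₀v : ∀ x : Fin n → ℝ, x ⬝ᵥ A *ᵥ x = 0 → x ⬝ᵥ B *ᵥ x = 0 → x ⬝ᵥ C₀ *ᵥ x = 0 := by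
    intro x hA hB
    simp [hC₀, sub_mulVec, add_mulVec, smul_mulVec, hA, hB, hvanish x hA hB]
  have hC₀z : C₀ *ᵥ z = 0 := by
    rw [hC₀, sub_mulVec, add_mulVec, smul_mulVec, smul_mulVec, h₀, sub_self]
  by_contra hne
  obtain ⟨y, hy, hC₀y⟩ : ∃ y ∈ S, C₀ *ᵥ y ≠ 0 := by
    by_contra! hcon
    have hker : Submodule.span ℝ S ≤ LinearMap.ker C₀.mulVecLin := Submodule.span_le.2 hcon
    rw [hspan, top_le_iff, LinearMap.ker_eq_top] at hker
    exact hne (Matrix.toLin'.injective (hker.trans (map_zero _).symm))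
  obtain ⟨hyA, hyB, hyI⟩ := hSN y hy
  obtain ⟨α, β, h⟩ := exists_multipliers hAs hBs hC₀s hC₀v hyA hyB hyI
  set F := α • A + β • B with hF
  have hFs : F.IsSymm := (hAs.smul _).add (hBs.smul _)
  have hFapp (x) : F *ᵥ x = α • A *ᵥ x + β • B *ᵥ x := by
    rw [hF, add_mulVec, smul_mulVec, smul_mulVec]
  have hr0 : C₀.rank ≤ 4 := rank_le_four_of_mulVec_eq_zero hAs hBs hC₀s hC₀v hzA hzB hzI hC₀z
  have hr1 : (C₀ - F).rank ≤ 4 :=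
    rank_le_four_of_mulVec_eq_zero hAs hBs (hC₀s.sub hFs)
      (fun x hA hB => by simp [sub_mulVec, hFapp, hA, hB, hC₀v x hA hB]) hyA hyB hyI
      (by rw [sub_mulVec, h, hFapp, sub_self])
  obtain ⟨k, hCk, hDk, hAk⟩ := exists_mem_ker_quad_ne_zero (C := C₀) (D := C₀ - F) hAs (by omega)
  have hFk : F *ᵥ k = 0 := by simpa [sub_mulVec, hCk] using hDk
  have hβ : β ≠ 0 := by
    rintro rfl
    have hα : α = 0 := by
      have hk := congrArg (k ⬝ᵥ ·) ((hFapp k).symm.trans hFk)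
      simpa [hAk] using hk
    exact hC₀y (by rw [h, hα]; simp)
  refine hne (eq_zero_of_isPreconnected_of_span_eq_top hFs hAs hC₀s ?_ hFk hCk hAk hS ?_
    (fun x hx => (hSN x hx).1) ?_ hspan hz hC₀z)
  · intro x hxF hxA
    refine hC₀v x hxA ?_
    simpa [hFapp, hxA, hβ] using hxF
  · intro x hx
    simp [hFapp, (hSN x hx).1, (hSN x hx).2.1]
  · intro x hx
    refine LinearIndependent.pair_iff.2 fun s t hst => ?_
    have hst' : (s * α + t) • A *ᵥ x + (s * β) • B *ᵥ x = 0 := by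
      rw [← hst, hFapp]; module
    obtain ⟨h1, h2⟩ := LinearIndependent.pair_iff.1 (hSN x hx).2.2 _ _ hst'
    have hs : s = 0 := (mul_eq_zero.1 h2).resolve_right hβ
    exact ⟨hs, by simpa [hs] using h1⟩

end QuadricPair

/-- **Theorem 3.12.** Let `A, B, C ∈ Sym(n,ℝ)` with `A, B` linearly
independent, forming a non-dissipative pair with `max{rank A, rank B} ≥ 17`, and with `Q_C`
vanishing on `{Q_A = 0} ∩ {Q_B = 0}`. If at least one connected component of the transversal
intersection set `𝒩` spans `ℝⁿ`, then `C` is a linear combination of `A` and `B`. -/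
theorem linear_combination_of_component_spans {n : ℕ}
    (A B C : Matrix (Fin n) (Fin n) ℝ)
    (hAs : A.IsSymm) (hBs : B.IsSymm) (hCs : C.IsSymm)
    (hind : LinearIndependent ℝ ![A, B])
    (hnd : ∀ F ∈ Submodule.span ℝ ({A, B} : Set (Matrix (Fin n) (Fin n) ℝ)),
      F.PosSemidef → F = 0)
    (hrank : 17 ≤ max A.rank B.rank)
    (hvanish : ∀ x : Fin n → ℝ, x ⬝ᵥ A.mulVec x = 0 → x ⬝ᵥ B.mulVec x = 0 →
      x ⬝ᵥ C.mulVec x = 0)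
    (N : Set (Fin n → ℝ))
    (hN : N = {z : Fin n → ℝ | z ⬝ᵥ A.mulVec z = 0 ∧ z ⬝ᵥ B.mulVec z = 0 ∧
      LinearIndependent ℝ ![A.mulVec z, B.mulVec z]})
    (hspan : ∃ z ∈ N, Submodule.span ℝ (connectedComponentIn N z) = ⊤) :
    ∃ α β : ℝ, C = α • A + β • B := by
  obtain ⟨z, hz, hspan⟩ := hspan
  have hSN : ∀ y ∈ connectedComponentIn N z, y ⬝ᵥ A *ᵥ y = 0 ∧ y ⬝ᵥ B *ᵥ y = 0 ∧
      LinearIndependent ℝ ![A *ᵥ y, B *ᵥ y] := fun y hy => by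
    have := connectedComponentIn_subset N z hy
    rwa [hN] at this
  have hzS := mem_connectedComponentIn hz
  rcases le_max_iff.1 hrank with h | h
  · exact QuadricPair.exists_smul_add_smul_of_rank hAs hBs hCs h hvanish
      isPreconnected_connectedComponentIn hSN hspan hzS
  · obtain ⟨α, β, hC⟩ := QuadricPair.exists_smul_add_smul_of_rank hBs hAs hCs h
      (fun x hB hA => hvanish x hA hB) isPreconnected_connectedComponentIn
      (fun y hy => ⟨(hSN y hy).2.1, (hSN y hy).1,
        LinearIndependent.pair_symm_iff.1 (hSN y hy).2.2⟩) hspan hzS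
    exact ⟨β, α, by rw [hC, add_comm]⟩
end
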